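/- Let (W,S) be the affine Coxeter system of type Ẽ_6: S = {0,1,...,6} with m(1,3) = m(3,4) = m(4,5) = m(5,6) = m(2,4) = m(0,2) = 3 and all other pairs commuting (m = 2). Then the homology of the weighted complex C_*(W) is: H_0 ≅ R/(Φ_2); H_1 = H_2 = 0; H_3 ≅ R/(Φ_3); H_4 ≅ R/(Φ_5) ⊕ R/(Φ_8); H_5 ≅ R/(Φ_2) ⊕ (R/(Φ_3))³ ⊕ (R/(Φ_6))² ⊕ (R/(Φ_9))² ⊕ (R/(Φ_12))²; H_6 ≅ R; and H_k = 0 for all k ≥ 7. -/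

import Mathlib

open Polynomial CoxeterSystem

set_option synthInstance.maxHeartbeats 1000000
set_option maxHeartbeats 1000000

noncomputable section

/-- The ring `R = ℚ[q,q⁻¹]` of Laurent polynomials over `ℚ`. -/
abbrev R : Type := LaurentPolynomial ℚ

/-- The image of the `d`-th cyclotomic polynomial `Φ_d` in `R`. -/
def cyc (d : ℕ) : R := Polynomial.toLaurent (Polynomial.cyclotomic d ℚ)

/-- The `R`-module `R/(Φ_d)`. -/
abbrev CycQuot (d : ℕ) := R ⧸ Ideal.span {cyc d}

variable {B : Type*} [Fintype B] [LinearOrder B] {W : Type*} [Group W]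
  {M : CoxeterMatrix B} (cs : CoxeterSystem M W)

/-- The standard parabolic subgroup `W_σ` generated by `σ ⊆ S`. -/
def parabolic (σ : Finset B) : Subgroup W := Subgroup.closure (cs.simple '' σ)

/-- The Poincaré polynomial `W_σ(q) = Σ_{w ∈ W_σ} q^{ℓ(w)}` of the standard parabolic
subgroup `W_σ` (defined to be `0` if `W_σ` is infinite). -/
def poin (σ : Finset B) : ℚ[X] :=
  letI := Classical.dec ((parabolic cs σ : Set W).Finite)
  if h : (parabolic cs σ : Set W).Finite then ∑ w ∈ h.toFinset, X ^ cs.length w else 0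

/-- The set of simplices `σ ∈ K_W` with `|σ| = k`, i.e. the subsets of `S` of
cardinality `k` generating a finite standard parabolic subgroup. -/
abbrev KW (k : ℕ) := {σ : Finset B // σ.card = k ∧ (parabolic cs σ : Set W).Finite}

noncomputable instance (k : ℕ) : Fintype (KW cs k) := Fintype.ofFinite _

/-- The coefficient of `e_τ` in `∂ e_σ`: it is
`(−1)^{#{t ∈ σ : t < s}} · W_σ(q)/W_{σ∖{s}}(q)` if `τ = σ ∖ {s}` for some `s ∈ σ`,
and `0` otherwise. -/
def bcoeff (σ τ : Finset B) : R :=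
  ∑ s ∈ σ, if τ = σ.erase s then
      (-1 : R) ^ (σ.filter (fun t => t < s)).card *
        Polynomial.toLaurent (poin cs σ / poin cs τ)
    else 0

/-- The boundary map `∂ : C_{k+1} → C_k` of the weighted complex `C_*(W)`, where
`C_k = ⊕_{σ ∈ K_W, |σ| = k} R·e_σ`. -/
def bdry (k : ℕ) : (KW cs (k + 1) → R) →ₗ[R] (KW cs k → R) :=
  Matrix.mulVecLin (Matrix.of fun (τ : KW cs k) (σ : KW cs (k + 1)) => bcoeff cs σ.1 τ.1)

/-- The submodule of cycles in degree `k` of the weighted complex. -/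
def cycles : (k : ℕ) → Submodule R (KW cs k → R)
  | 0 => ⊤
  | (k + 1) => LinearMap.ker (bdry cs k)

/-- The `k`-th homology `H_k(C_*(W))` of the weighted complex: cycles modulo boundaries. -/
abbrev Hgy (k : ℕ) :=
  cycles cs k ⧸ Submodule.comap (cycles cs k).subtype (LinearMap.range (bdry cs k))

end

section Roots

variable {B W V : Type*} [Group W] {M : CoxeterMatrix B} [AddCommGroup V]

theorem simple_comm_of_eq_two (cs : CoxeterSystem M W) {i j : B} (h : M i j = 2) :
    cs.simple i * cs.simple j = cs.simple j * cs.simple i := by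
  have := cs.simple_mul_simple_pow i j
  rw [h, pow_two, mul_eq_one_iff_eq_inv] at this
  simpa using this

theorem simple_braid_of_eq_three (cs : CoxeterSystem M W) {i j : B} (h : M i j = 3) :
    cs.simple i * cs.simple j * cs.simple i = cs.simple j * cs.simple i * cs.simple j := by
  have := cs.simple_mul_simple_pow i j
  rw [h, pow_succ, pow_two, mul_assoc (cs.simple i * cs.simple j),
    ← mul_assoc (cs.simple i * cs.simple j) (cs.simple i), mul_eq_one_iff_eq_inv'] at this
  have h3 := congrArg (· * cs.simple j) this
  simp only [mul_inv_rev, cs.inv_simple, mul_assoc, cs.simple_mul_simple_self, mul_one] at h3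
  simpa [mul_assoc] using h3

/-- In a simply laced Coxeter system, `w` sends the simple root `α i` to a nonnegative
root as soon as `i` is not a right descent of `w`. -/
theorem root_nonneg_of_length_lt (cs : CoxeterSystem M W)
    (hM : ∀ i j, i ≠ j → M i j = 2 ∨ M i j = 3) (ρ : W →* Module.End ℤ V) (α : B → V)
    (P : AddSubmonoid V) (hα : ∀ i, α i ∈ P)
    (h2 : ∀ i j, M i j = 2 → ρ (cs.simple i) (α j) = α j)
    (h3 : ∀ i j, M i j = 3 → ρ (cs.simple i) (α j) = α i + α j)
    (w : W) (i : B) (h : cs.length w < cs.length (w * cs.simple i)) : ρ w (α i) ∈ P := by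
  induction hn : cs.length w using Nat.strong_induction_on generalizing w i with
  | _ n ih =>
  subst hn
  by_cases hw : w = 1
  · subst hw; simpa using hα i
  obtain ⟨j, hj⟩ := cs.exists_rightDescent_of_ne_one hw
  have hj' : cs.length (w * cs.simple j) < cs.length w := hj
  have hij : j ≠ i := by rintro rfl; omega
  obtain ⟨v, rfl⟩ : ∃ v, w = v * cs.simple j := ⟨w * cs.simple j, by simp⟩
  rw [cs.simple_mul_simple_cancel_right] at hj'
  have e1 := cs.length_mul_simple v j
  rcases hM j i hij with hm | hm
  · have hc := simple_comm_of_eq_two cs hm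
    rw [map_mul, Module.End.mul_apply, h2 j i hm]
    refine ih _ hj' v i ?_ rfl
    rw [mul_assoc, hc, ← mul_assoc] at h
    have := cs.length_mul_simple v i
    have := cs.length_mul_simple (v * cs.simple i) j
    omega
  · have hb := simple_braid_of_eq_three cs hm
    by_cases hv : cs.length v < cs.length (v * cs.simple i)
    · rw [map_mul, Module.End.mul_apply, h3 j i hm, map_add]
      refine P.add_mem (ih _ hj' v j ?_ rfl) (ih _ hj' v i hv rfl)
      omega
    · obtain ⟨u, rfl⟩ : ∃ u, v = u * cs.simple i := ⟨v * cs.simple i, by simp⟩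
      rw [cs.simple_mul_simple_cancel_right] at hv
      have e2 := cs.length_mul_simple u i
      have hm' : M i j = 3 := by rw [M.symmetric]; exact hm
      have key : ρ (u * cs.simple i * cs.simple j) (α i) = ρ u (α j) := by
        have e : ρ (cs.simple i) (α i + α j) = α j := by
          rw [add_comm, ← add_comm (α i), ← h3 i j hm', ← Module.End.mul_apply, ← map_mul]
          simp
        rw [map_mul, map_mul, Module.End.mul_apply, Module.End.mul_apply, h3 j i hm,
          add_comm, e]
      rw [key]
      refine ih _ (by omega) u j ?_ rfl
      have e3 : u * cs.simple i * cs.simple j * cs.simple i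
          = u * cs.simple j * cs.simple i * cs.simple j := by
        rw [mul_assoc, mul_assoc, ← mul_assoc (cs.simple i), ← hb]; simp [mul_assoc]
      rw [e3] at h
      have := cs.length_mul_simple u j
      have := cs.length_mul_simple (u * cs.simple j) i
      have := cs.length_mul_simple (u * cs.simple j * cs.simple i) j
      omega

end Roots

section Reflections

variable {V : Type*} [AddCommGroup V]

theorem preReflection_mul_pow_two {e e' : V} {f f' : Module.Dual ℤ V} (h : f e = 2)
    (h' : f' e' = 2) (h1 : f e' = 0) (h2 : f' e = 0) :
    (Module.preReflection e f * Module.preReflection e' f') ^ 2 = 1 := by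
  ext v
  simp only [pow_succ, pow_zero, one_mul, Module.End.mul_apply, Module.preReflection_apply,
    map_sub, map_smul, h, h', h1, h2, Module.End.one_apply]
  module

theorem preReflection_mul_pow_three {e e' : V} {f f' : Module.Dual ℤ V} (h : f e = 2)
    (h' : f' e' = 2) (h1 : f e' = -1) (h2 : f' e = -1) :
    (Module.preReflection e f * Module.preReflection e' f') ^ 3 = 1 := by
  ext v
  simp only [pow_succ, pow_zero, one_mul, Module.End.mul_apply, Module.preReflection_apply,
    map_sub, map_smul, h, h', h1, h2, Module.End.one_apply]
  module

end Reflections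

section AffineE6

/-- Adjacency in the affine Dynkin diagram of type `Ẽ₆`. -/
def adjE6 (i j : Fin 7) : Bool :=
  ([(0, 2), (1, 3), (2, 4), (3, 4), (4, 5), (5, 6)] : List (ℕ × ℕ)).any fun p =>
    p == (i.val, j.val) || p == (j.val, i.val)

/-- The Cartan matrix of type `Ẽ₆`. -/
def cartanE6 (i j : Fin 7) : ℤ := if i = j then 2 else if adjE6 i j then -1 else 0

/-- The defining property of the Coxeter matrix of type `Ẽ₆`. -/
def IsAffineE6 (Mat : CoxeterMatrix (Fin 7)) : Prop :=
  ∀ i j, i ≠ j → Mat i j = if adjE6 i j then 3 else 2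

/-- The functional on the root lattice pairing with the simple coroot `i`. -/
def corootE6 (i : Fin 7) : Module.Dual ℤ (Fin 7 → ℤ) := ∑ j, cartanE6 i j • LinearMap.proj j

/-- The simple root `i`. -/
def rootE6 (i : Fin 7) : Fin 7 → ℤ := Pi.single i 1

theorem corootE6_rootE6 (i j : Fin 7) : corootE6 i (rootE6 j) = cartanE6 i j := by
  simp [corootE6, rootE6, LinearMap.sum_apply, Pi.single_apply]

theorem cartanE6_comm : ∀ i j, cartanE6 i j = cartanE6 j i := by decide

variable {W : Type*} [Group W] {Mat : CoxeterMatrix (Fin 7)} (cs : CoxeterSystem Mat W)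
  (hM : IsAffineE6 Mat)

include hM in
theorem isLiftable_preReflection :
    Mat.IsLiftable fun i => Module.preReflection (rootE6 i) (corootE6 i) := by
  intro i j
  have hd : ∀ i, corootE6 i (rootE6 i) = 2 := fun i => by simp [corootE6_rootE6, cartanE6]
  by_cases hij : i = j
  · subst hij
    rw [Mat.diagonal, pow_one]
    exact Module.involutive_preReflection (hd i) |> fun h => LinearMap.ext h
  · have hji : corootE6 j (rootE6 i) = corootE6 i (rootE6 j) := by
      rw [corootE6_rootE6, corootE6_rootE6, cartanE6_comm]
    have hc : corootE6 i (rootE6 j) = if adjE6 i j then -1 else 0 := by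
      rw [corootE6_rootE6, cartanE6, if_neg hij]
    rw [hM i j hij]
    split_ifs with ha
    · rw [if_pos ha] at hc
      exact preReflection_mul_pow_three (hd i) (hd j) hc (hji.trans hc)
    · rw [if_neg ha] at hc
      exact preReflection_mul_pow_two (hd i) (hd j) hc (hji.trans hc)

/-- The reflection representation of the Coxeter group of type `Ẽ₆` on the root lattice. -/
noncomputable def repE6 : W →* Module.End ℤ (Fin 7 → ℤ) :=
  cs.lift ⟨_, isLiftable_preReflection hM⟩

theorem repE6_simple (i : Fin 7) :
    repE6 cs hM (cs.simple i) = Module.preReflection (rootE6 i) (corootE6 i) :=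
  cs.lift_apply_simple _ i

theorem repE6_simple_root (i j : Fin 7) :
    repE6 cs hM (cs.simple i) (rootE6 j) = rootE6 j - cartanE6 i j • rootE6 i := by
  rw [repE6_simple, Module.preReflection_apply, corootE6_rootE6]

theorem repE6_mul_simple_root (w : W) (i j : Fin 7) :
    repE6 cs hM (w * cs.simple i) (rootE6 j)
      = repE6 cs hM w (rootE6 j) - cartanE6 i j • repE6 cs hM w (rootE6 i) := by
  rw [map_mul, Module.End.mul_apply, repE6_simple_root, map_sub, map_smul]

/-- The nonnegative vectors of the root lattice. -/
noncomputable def nonnegE6 : AddSubmonoid (Fin 7 → ℤ) := AddSubmonoid.nonneg _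

theorem rootE6_mem_nonnegE6 (i : Fin 7) : rootE6 i ∈ nonnegE6 :=
  Pi.single_nonneg.2 zero_le_one

/-- The Coxeter matrix of the parabolic subsystem on `J`. -/
def subMatrix (Mat : CoxeterMatrix (Fin 7)) (J : Finset (Fin 7)) : CoxeterMatrix J where
  M := Mat.M.submatrix Subtype.val Subtype.val
  isSymm := Mat.isSymm.submatrix _
  diagonal i := Mat.diagonal i
  off_diagonal i j h := Mat.off_diagonal i j (fun h' => h (Subtype.ext h'))

/-- The homomorphism onto the parabolic subgroup of `J` from the Coxeter group of the
parabolic subsystem on `J`. -/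
noncomputable def subHom (J : Finset (Fin 7)) : (subMatrix Mat J).Group →* W :=
  (subMatrix Mat J).toCoxeterSystem.lift ⟨fun i => cs.simple i.1,
    fun i j => cs.simple_mul_simple_pow i.1 j.1⟩

theorem subHom_simple (J : Finset (Fin 7)) (i : J) :
    subHom cs J ((subMatrix Mat J).toCoxeterSystem.simple i) = cs.simple i.1 :=
  (subMatrix Mat J).toCoxeterSystem.lift_apply_simple _ i

theorem parabolic_le_range_subHom (J : Finset (Fin 7)) :
    parabolic cs J ≤ (subHom cs J).range := by
  rw [parabolic, Subgroup.closure_le]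
  rintro _ ⟨i, hi, rfl⟩
  exact ⟨_, subHom_simple cs J ⟨i, hi⟩⟩

theorem simple_mem_parabolic {J : Finset (Fin 7)} {i : Fin 7} (hi : i ∈ J) :
    cs.simple i ∈ parabolic cs J := Subgroup.subset_closure ⟨i, hi, rfl⟩

theorem parabolic_mono {I J : Finset (Fin 7)} (h : I ⊆ J) : parabolic cs I ≤ parabolic cs J :=
  Subgroup.closure_mono (Set.image_mono (Finset.coe_subset.2 h))

theorem neg_root_mem_of_isRightDescent {B : Type*} {W' : Type*} [Group W'] {M : CoxeterMatrix B}
    (cs' : CoxeterSystem M W') (π : W' →* W) (f : B → Fin 7)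
    (hMf : ∀ i j, i ≠ j → f i ≠ f j) (hf : ∀ i j, M i j = Mat (f i) (f j))
    (hπ : ∀ i, π (cs'.simple i) = cs.simple (f i)) (w : W') (i : B)
    (h : cs'.IsRightDescent w i) : -repE6 cs hM (π w) (rootE6 (f i)) ∈ nonnegE6 := by
  have e : -repE6 cs hM (π w) (rootE6 (f i))
      = ((repE6 cs hM).comp π) (w * cs'.simple i) (rootE6 (f i)) := by
    rw [MonoidHom.comp_apply, map_mul, hπ, repE6_mul_simple_root, cartanE6, if_pos rfl]
    module
  rw [e]
  have hM' : ∀ i j, i ≠ j → M i j = if adjE6 (f i) (f j) then 3 else 2 :=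
    fun i j hij => (hf i j).trans (hM _ _ (hMf i j hij))
  have hs : ∀ i j, i ≠ j → ((repE6 cs hM).comp π) (cs'.simple i) (rootE6 (f j))
      = rootE6 (f j) + (if adjE6 (f i) (f j) then 1 else 0) • rootE6 (f i) := by
    intro i j hij
    rw [MonoidHom.comp_apply, hπ, repE6_simple_root, cartanE6, if_neg (hMf i j hij)]
    split_ifs <;> simp
  refine root_nonneg_of_length_lt cs' ?_ ((repE6 cs hM).comp π) (fun i => rootE6 (f i)) nonnegE6
    (fun i => rootE6_mem_nonnegE6 _) ?_ ?_ _ i ?_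
  · intro i j hij
    rw [hM' i j hij]
    split_ifs <;> simp
  · intro i j h
    have hij : i ≠ j := by rintro rfl; rw [M.diagonal] at h; omega
    rw [hM' i j hij] at h
    rw [hs i j hij]
    split_ifs at h ⊢ <;> simp_all
  · intro i j h
    have hij : i ≠ j := by rintro rfl; rw [M.diagonal] at h; omega
    rw [hM' i j hij] at h
    rw [hs i j hij]
    split_ifs at h ⊢ <;> simp_all [add_comm]
  · simpa [IsRightDescent] using h

theorem neg_root_mem_of_length_lt {w : W} {i : Fin 7}
    (h : cs.length (w * cs.simple i) < cs.length w) :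
    -repE6 cs hM w (rootE6 i) ∈ nonnegE6 :=
  neg_root_mem_of_isRightDescent cs hM cs (MonoidHom.id W) id (fun _ _ h => h)
    (fun _ _ => rfl) (fun _ => rfl) w i h

/-- The `s`-th row of the matrix of `w` in the reflection representation. -/
noncomputable def rowE6 (s : Fin 7) (w : W) : List ℤ :=
  List.ofFn fun j => repE6 cs hM w (rootE6 j) s

/-- The action of the simple reflection `t` on rows. -/
def stepE6 (t : Fin 7) (l : List ℤ) : List ℤ :=
  List.ofFn fun j : Fin 7 => l.getD j 0 - cartanE6 t j * l.getD t 0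

theorem rowE6_getD (s t : Fin 7) (w : W) :
    (rowE6 cs hM s w).getD t 0 = repE6 cs hM w (rootE6 t) s := by
  rw [rowE6, List.getD_eq_getElem _ _ (by simp), List.getElem_ofFn]

theorem rowE6_mul_simple (s t : Fin 7) (w : W) :
    rowE6 cs hM s (w * cs.simple t) = stepE6 t (rowE6 cs hM s w) := by
  unfold stepE6
  simp only [rowE6_getD]
  refine congrArg List.ofFn (funext fun j => ?_)
  rw [repE6_mul_simple_root, Pi.sub_apply, Pi.smul_apply, smul_eq_mul]

theorem stepE6_rowE6_of_eq_zero {s t : Fin 7} {w : W} (h : (rowE6 cs hM s w).getD t 0 = 0) :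
    stepE6 t (rowE6 cs hM s w) = rowE6 cs hM s w := by
  unfold stepE6
  rw [h]
  simp only [rowE6_getD, mul_zero, sub_zero]
  rfl

theorem length_mul_simple_of_row_pos {s t : Fin 7} {w : W}
    (h : 0 < (rowE6 cs hM s w).getD t 0) :
    cs.length (w * cs.simple t) = cs.length w + 1 := by
  refine (cs.length_mul_simple w t).resolve_right fun h' => ?_
  have := neg_root_mem_of_length_lt cs hM (w := w) (i := t) (by omega) s
  rw [rowE6_getD] at h
  simp only [Pi.zero_apply, Pi.neg_apply] at this
  omega

theorem mem_parabolic_erase_of_row_eq {J : Finset (Fin 7)} {s : Fin 7} {w : W}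
    (hw : w ∈ parabolic cs J) (h : rowE6 cs hM s w = rowE6 cs hM s 1) :
    w ∈ parabolic cs (J.erase s) := by
  obtain ⟨g, rfl⟩ := parabolic_le_range_subHom cs J hw
  clear hw
  set cs' := (subMatrix Mat J).toCoxeterSystem with hcs
  induction hn : cs'.length g using Nat.strong_induction_on generalizing g with
  | _ n ih =>
  subst hn
  by_cases hg : g = 1
  · subst hg; simp
  obtain ⟨t, ht⟩ := cs'.exists_rightDescent_of_ne_one hg
  have hroot := neg_root_mem_of_isRightDescent cs hM cs' (subHom cs J) Subtype.val
    (fun _ _ h => fun h' => h (Subtype.ext h')) (fun _ _ => rfl) (subHom_simple cs J) g t ht s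
  have h1 : (rowE6 cs hM s (1 : W)).getD t.1 0 = if s = t.1 then 1 else 0 := by
    rw [rowE6_getD, map_one, Module.End.one_apply, rootE6, Pi.single_apply]
  have hgt := rowE6_getD cs hM s t.1 (subHom cs J g)
  rw [h, h1] at hgt
  simp only [Pi.zero_apply, Pi.neg_apply, ← hgt] at hroot
  have hst : s ≠ t.1 := by rintro rfl; simp at hroot
  have hmul : subHom cs J (g * cs'.simple t) = subHom cs J g * cs.simple t.1 := by
    rw [map_mul, hcs, subHom_simple]
  have := ih _ ht (g * cs'.simple t) (by
    rw [hmul, rowE6_mul_simple, stepE6_rowE6_of_eq_zero, h]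
    rw [h, h1, if_neg hst]) rfl
  rw [hmul] at this
  simpa using mul_mem this
    (simple_mem_parabolic cs (Finset.mem_erase.2 ⟨hst.symm, t.2⟩))

theorem rowE6_of_mem_parabolic_erase {J : Finset (Fin 7)} {s : Fin 7} {w : W}
    (hw : w ∈ parabolic cs (J.erase s)) : rowE6 cs hM s w = rowE6 cs hM s 1 := by
  rw [parabolic] at hw
  have hs : ∀ t ∈ J.erase s, (rowE6 cs hM s (1 : W)).getD t 0 = 0 := by
    intro t ht
    rw [rowE6_getD, map_one, Module.End.one_apply, rootE6, Pi.single_apply,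
      if_neg (Finset.ne_of_mem_erase ht).symm]
  induction hw using Subgroup.closure_induction_right with
  | one => rfl
  | mul_right x hx y hy ih =>
    obtain ⟨t, ht, rfl⟩ := hy
    rw [rowE6_mul_simple, stepE6_rowE6_of_eq_zero, ih]
    rw [ih, hs t ht]
  | mul_inv_cancel x hx y hy ih =>
    obtain ⟨t, ht, rfl⟩ := hy
    rw [cs.inv_simple, rowE6_mul_simple, stepE6_rowE6_of_eq_zero, ih]
    rw [ih, hs t ht]

include cs hM in
theorem infinite_affineE6 : Infinite W := by
  by_contra hfin
  have : Finite W := not_infinite_iff_finite.1 hfin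
  obtain ⟨w, hw⟩ := Finite.exists_max (fun w : W => cs.length w)
  let δ : Fin 7 → ℤ := ![1, 1, 2, 2, 3, 2, 1]
  have hδ : ∀ i, corootE6 i δ = 0 := by
    intro i
    simp only [corootE6, LinearMap.sum_apply, LinearMap.smul_apply, LinearMap.proj_apply]
    revert i; decide
  have hδ0 : ∀ i, 0 ≤ δ i := by decide
  have hfix : repE6 cs hM w δ = δ := by
    clear hw
    refine cs.simple_induction_left (p := fun w => repE6 cs hM w δ = δ) w (by simp) fun w i ih => ?_
    rw [map_mul, Module.End.mul_apply, ih, repE6_simple, Module.preReflection_apply, hδ,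
      zero_smul, sub_zero]
  have hsum : δ = ∑ i, δ i • rootE6 i := by
    ext j; simp [rootE6, Pi.single_apply]
  have h0 : (repE6 cs hM w δ) 0 ≤ 0 := by
    rw [hsum, map_sum, Finset.sum_apply]
    refine Finset.sum_nonpos fun i _ => ?_
    have h1 := neg_root_mem_of_length_lt cs hM (w := w) (i := i)
      (lt_of_le_of_ne (hw _) (cs.length_mul_simple_ne w i)) 0
    have h2 := hδ0 i
    rw [map_smul, Pi.smul_apply, smul_eq_mul]
    simp only [Pi.zero_apply, Pi.neg_apply] at h1
    nlinarith
  rw [hfix] at h0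
  exact absurd h0 (by decide)

end AffineE6

section PoincarePolynomial

variable {W : Type*} [Group W] {Mat : CoxeterMatrix (Fin 7)} (cs : CoxeterSystem Mat W)
  (hM : IsAffineE6 Mat)

/-- `L` lists the orbit of the `s`-th basis row under the parabolic subgroup of `J`, together
with the lengths of the minimal elements reaching its members. -/
def IsOrbitList (J : Finset (Fin 7)) (s : Fin 7) (L : List (List ℤ × ℕ)) : Prop :=
  (L.map Prod.fst).Nodup ∧
  (List.ofFn fun j : Fin 7 => if s = j then (1 : ℤ) else 0, 0) ∈ L ∧
  (∀ x ∈ L, x.2 = 0 → x.1 = List.ofFn fun j : Fin 7 => if s = j then (1 : ℤ) else 0) ∧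
  (∀ x ∈ L, x.2 ≠ 0 → ∃ t ∈ J, x.1.getD t 0 < 0 ∧ stepE6 t (stepE6 t x.1) = x.1) ∧
  ∀ x ∈ L, ∀ t ∈ J, x.1.getD t 0 = 0 ∨ (0 < x.1.getD t 0 ∧ (stepE6 t x.1, x.2 + 1) ∈ L) ∨
    (x.1.getD t 0 < 0 ∧ 0 < x.2 ∧ (stepE6 t x.1, x.2 - 1) ∈ L)

theorem rowE6_one (s : Fin 7) :
    rowE6 cs hM s 1 = List.ofFn fun j : Fin 7 => if s = j then (1 : ℤ) else 0 := by
  unfold rowE6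
  refine congrArg List.ofFn (funext fun j => ?_)
  rw [map_one, Module.End.one_apply, rootE6, Pi.single_apply]

theorem stepE6_getD_self (t : Fin 7) (l : List ℤ) :
    (stepE6 t l).getD t 0 = -l.getD t 0 := by
  have h : cartanE6 t t = 2 := if_pos rfl
  rw [stepE6, List.getD_eq_getElem _ _ (by simp), List.getElem_ofFn, h]
  ring

theorem poin_of_finite {J : Finset (Fin 7)} (h : (parabolic cs J : Set W).Finite) :
    poin cs J = ∑ᶠ w ∈ (parabolic cs J : Set W), (X : ℚ[X]) ^ cs.length w := by
  rw [poin, dif_pos h, finsum_mem_eq_finite_toFinset_sum _ h]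

theorem row_mem_of_mem_parabolic {J : Finset (Fin 7)} {s : Fin 7}
    {L : List (List ℤ × ℕ)} (hL : IsOrbitList J s L) {w : W} (hw : w ∈ parabolic cs J) :
    ∃ n, (rowE6 cs hM s w, n) ∈ L := by
  have key : ∀ x : W, ∀ t ∈ J, (∃ n, (rowE6 cs hM s x, n) ∈ L) →
      ∃ n, (rowE6 cs hM s (x * cs.simple t), n) ∈ L := by
    rintro x t ht ⟨n, hn⟩
    rw [rowE6_mul_simple]
    rcases hL.2.2.2.2 _ hn t ht with h | ⟨-, h⟩ | ⟨-, -, h⟩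
    · exact ⟨n, by rwa [stepE6_rowE6_of_eq_zero cs hM h]⟩
    · exact ⟨_, h⟩
    · exact ⟨_, h⟩
  rw [parabolic] at hw
  induction hw using Subgroup.closure_induction_right with
  | one => exact ⟨0, by rw [rowE6_one]; exact hL.2.1⟩
  | mul_right x hx y hy ih =>
    obtain ⟨t, ht, rfl⟩ := hy
    exact key x t ht ih
  | mul_inv_cancel x hx y hy ih =>
    obtain ⟨t, ht, rfl⟩ := hy
    rw [cs.inv_simple]
    exact key x t ht ih

theorem fiber_finite_and_finsum {J : Finset (Fin 7)} {s : Fin 7} {L : List (List ℤ × ℕ)}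
    (hL : IsOrbitList J s L) (hI : (parabolic cs (J.erase s) : Set W).Finite) (n : ℕ) :
    ∀ l, (l, n) ∈ L → {w | w ∈ parabolic cs J ∧ rowE6 cs hM s w = l}.Finite ∧
      ∑ᶠ w ∈ {w | w ∈ parabolic cs J ∧ rowE6 cs hM s w = l}, (X : ℚ[X]) ^ cs.length w
        = X ^ n * poin cs (J.erase s) := by
  induction n with
  | zero =>
    intro l hl
    have hl' := hL.2.2.1 _ hl rfl
    rw [← rowE6_one cs hM] at hl'
    simp only at hl'
    subst hl'
    have e : {w | w ∈ parabolic cs J ∧ rowE6 cs hM s w = rowE6 cs hM s 1}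
        = (parabolic cs (J.erase s) : Set W) := by
      ext w
      refine ⟨fun h => mem_parabolic_erase_of_row_eq cs hM h.1 h.2, fun h => ⟨?_, ?_⟩⟩
      · exact parabolic_mono cs (Finset.erase_subset _ _) h
      · exact rowE6_of_mem_parabolic_erase cs hM h
    rw [e, pow_zero, one_mul, poin_of_finite cs hI]
    exact ⟨hI, rfl⟩
  | succ n ih =>
    intro l hl
    obtain ⟨t, ht, hneg, hinv⟩ := hL.2.2.2.1 _ hl n.succ_ne_zero
    simp only at hneg hinv
    have hmem : (stepE6 t l, n) ∈ L := by
      rcases hL.2.2.2.2 _ hl t ht with h | ⟨h, -⟩ | ⟨-, -, h⟩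
      · simp only at h; omega
      · simp only at h; omega
      · simpa using h
    obtain ⟨hfin, hsum⟩ := ih _ hmem
    have htJ := simple_mem_parabolic cs ht
    have e : {w | w ∈ parabolic cs J ∧ rowE6 cs hM s w = l} = (fun w => w * cs.simple t) ''
        {w | w ∈ parabolic cs J ∧ rowE6 cs hM s w = stepE6 t l} := by
      ext w
      constructor
      · rintro ⟨hw, rfl⟩
        exact ⟨w * cs.simple t, ⟨mul_mem hw htJ, rowE6_mul_simple cs hM s t w⟩, by simp⟩
      · rintro ⟨v, ⟨hv, hv'⟩, rfl⟩
        refine ⟨mul_mem hv htJ, ?_⟩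
        rw [rowE6_mul_simple, hv', hinv]
    refine ⟨e ▸ hfin.image _, ?_⟩
    rw [e, finsum_mem_image (mul_left_injective _).injOn, pow_succ', mul_assoc, ← hsum,
      mul_finsum_mem]
    refine finsum_mem_congr rfl fun v hv => ?_
    rw [length_mul_simple_of_row_pos cs hM (s := s), pow_succ']
    rw [hv.2, stepE6_getD_self]
    omega

include hM in
/-- The Poincaré polynomial of a parabolic subgroup in terms of that of a maximal
standard parabolic subgroup of it and of the lengths of the minimal coset representatives. -/
theorem finite_and_poin_eq_of_isOrbitList {J : Finset (Fin 7)} {s : Fin 7}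
    {L : List (List ℤ × ℕ)} (hL : IsOrbitList J s L)
    (hI : (parabolic cs (J.erase s) : Set W).Finite) :
    (parabolic cs J : Set W).Finite ∧
      poin cs J = (L.map fun x => (X : ℚ[X]) ^ x.2).sum * poin cs (J.erase s) := by
  classical
  let F : List ℤ × ℕ → Set W := fun x => {w | w ∈ parabolic cs J ∧ rowE6 cs hM s w = x.1}
  have hF := fun x (hx : x ∈ L) => fiber_finite_and_finsum cs hM hL hI x.2 x.1 hx
  have e : (parabolic cs J : Set W) = ⋃ x ∈ (L.toFinset : Set (List ℤ × ℕ)), F x := by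
    ext w
    simp only [Set.mem_iUnion, F, Set.mem_ofPred_eq, List.coe_toFinset]
    constructor
    · intro hw
      obtain ⟨n, hn⟩ := row_mem_of_mem_parabolic cs hM hL hw
      exact ⟨_, hn, hw, rfl⟩
    · rintro ⟨x, -, hw, -⟩
      exact hw
  have hfin : (parabolic cs J : Set W).Finite := by
    rw [e]
    exact (Finset.finite_toSet _).biUnion fun x hx => (hF x (by simpa using hx)).1
  refine ⟨hfin, ?_⟩
  rw [poin_of_finite cs hfin, e, finsum_mem_biUnion ?_ (Finset.finite_toSet _)
    fun x hx => (hF x (by simpa using hx)).1, finsum_mem_coe_finset,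
    Finset.sum_congr rfl fun x hx => (hF x (by simpa using hx)).2, ← Finset.sum_mul,
    List.sum_toFinset _ hL.1.of_map]
  intro x hx y hy hxy
  rw [Function.onFun, Set.disjoint_left]
  rintro w ⟨-, hw⟩ ⟨-, hw'⟩
  exact hxy (List.inj_on_of_nodup_map hL.1 (by simpa using hx) (by simpa using hy)
    (hw.symm.trans hw'))

end PoincarePolynomial

section Masks

/-- The subset of `{0, …, 6}` encoded by the binary digits of `m`. -/
def ofMask (m : ℕ) : Finset (Fin 7) := Finset.univ.filter fun i => m.testBit i

theorem mem_ofMask {m : ℕ} {i : Fin 7} : i ∈ ofMask m ↔ m.testBit i = true := by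
  simp [ofMask]

theorem ofMask_erase {m : ℕ} {s : Fin 7} (hs : m.testBit s = true) :
    (ofMask m).erase s = ofMask (m ^^^ 2 ^ (s : ℕ)) := by
  ext i
  rw [Finset.mem_erase, mem_ofMask, mem_ofMask, Nat.testBit_xor, Nat.testBit_two_pow]
  by_cases h : i = s
  · subst h; simp [hs]
  · have : ¬ (s : ℕ) = i := fun e => h (Fin.ext e.symm)
    simp [h, this]

/-- The orders `2, …, n + 1` of the geometric factors in type `A_n`. -/
def degsA (n : ℕ) : List ℕ := (List.range n).map (· + 2)

/-- The number of elements of the arm with middle vertex `mid` and end vertex `tip` in `m`. -/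
def armCard (m mid tip : ℕ) : ℕ := (m.testBit mid).toNat + (m.testBit tip).toNat

/-- The length of the part of an arm that is connected to the central vertex. -/
def armLen (m mid tip : ℕ) : ℕ :=
  if m.testBit mid then 1 + (m.testBit tip).toNat else 0

/-- The factor of an end vertex that is separated from the central vertex. -/
def armRest (m mid tip : ℕ) : List ℕ :=
  if m.testBit mid then [] else degsA (m.testBit tip).toNat

/-- The degrees of a star-shaped diagram with arms of lengths `a`, `b`, `c`. -/
def degsStar (a b c : ℕ) : List ℕ :=
  if a * b * c = 0 then degsA (1 + a + b + c)
  else if a * b * c = 1 then [2, 4, 4, 6]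
  else if a * b * c = 2 then [2, 4, 5, 6, 8]
  else [2, 5, 6, 8, 9, 12]

/-- The degrees of the parabolic subgroup of the affine group of type `E₆` encoded by `m`. -/
def degs (m : ℕ) : List ℕ :=
  if m.testBit 4 then
    degsStar (armLen m 2 0) (armLen m 3 1) (armLen m 5 6) ++
      armRest m 2 0 ++ armRest m 3 1 ++ armRest m 5 6
  else degsA (armCard m 2 0) ++ degsA (armCard m 3 1) ++ degsA (armCard m 5 6)

/-- A vertex of `m` that is a leaf of the subdiagram. -/
def leaf (m : ℕ) : Fin 7 := ([1, 6, 0, 2, 3, 5] : List (Fin 7)).find? (fun i : Fin 7 => m.testBit i) |>.getD 4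

/-- The lists obtained from those in `l` by a length increasing step in `m`. -/
def orbitStep (m : ℕ) (l : List (List ℤ)) : List (List ℤ) :=
  (l.flatMap fun x => (List.finRange 7).filterMap fun t : Fin 7 =>
    if m.testBit t && decide (0 < x.getD t 0) then some (stepE6 t x) else none).dedup

/-- Breadth first enumeration of an orbit, starting at level `k`. -/
def orbitLevels (m : ℕ) : ℕ → ℕ → List (List ℤ) → List (List ℤ × ℕ)
  | 0, _, _ => []
  | n + 1, k, l => l.map (·, k) ++ orbitLevels m n (k + 1) (orbitStep m l)

/-- The orbit of the basis row of `leaf m`. -/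
def orbitList (m : ℕ) : List (List ℤ × ℕ) :=
  orbitLevels m 18 0 [List.ofFn fun j : Fin 7 => if leaf m = j then (1 : ℤ) else 0]

/-- A decidable form of `IsOrbitList`. -/
def OrbitCheck (m : ℕ) (s : Fin 7) (L : List (List ℤ × ℕ)) : Prop :=
  (L.map Prod.fst).Nodup ∧
  (List.ofFn fun j : Fin 7 => if s = j then (1 : ℤ) else 0, 0) ∈ L ∧
  (∀ x ∈ L, x.2 = 0 → x.1 = List.ofFn fun j : Fin 7 => if s = j then (1 : ℤ) else 0) ∧
  (∀ x ∈ L, x.2 ≠ 0 → ∃ t ∈ List.finRange 7,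
    m.testBit t = true ∧ x.1.getD t 0 < 0 ∧ stepE6 t (stepE6 t x.1) = x.1) ∧
  ∀ x ∈ L, ∀ t ∈ List.finRange 7, m.testBit t = true → x.1.getD t 0 = 0 ∨
    (0 < x.1.getD t 0 ∧ (stepE6 t x.1, x.2 + 1) ∈ L) ∨
    (x.1.getD t 0 < 0 ∧ 0 < x.2 ∧ (stepE6 t x.1, x.2 - 1) ∈ L)

set_option synthInstance.maxSize 2000 in
instance (m : ℕ) (s : Fin 7) (L : List (List ℤ × ℕ)) : Decidable (OrbitCheck m s L) := by
  unfold OrbitCheck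
  infer_instance

theorem orbitCheck_orbitList : ∀ m < 127, 0 < m → OrbitCheck m (leaf m) (orbitList m) := by
  decide +kernel

theorem isOrbitList_orbitList {m : ℕ} (hm : m < 127) (h0 : 0 < m) :
    IsOrbitList (ofMask m) (leaf m) (orbitList m) := by
  obtain ⟨h1, h2, h3, h4, h5⟩ := orbitCheck_orbitList m hm h0
  refine ⟨h1, h2, h3, fun x hx hx0 => ?_, fun x hx t ht =>
    h5 x hx t (List.mem_finRange t) (mem_ofMask.1 ht)⟩
  obtain ⟨t, -, ht, h⟩ := h4 x hx hx0
  exact ⟨t, mem_ofMask.2 ht, h⟩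

theorem testBit_leaf : ∀ m < 127, 0 < m → m.testBit (leaf m) = true := by decide +kernel

theorem xor_leaf_lt : ∀ m < 127, 0 < m → m ^^^ 2 ^ (leaf m : ℕ) < m := by decide +kernel

/-- Sum of polynomials given by their coefficient lists. -/
def coeffAdd : List ℕ → List ℕ → List ℕ
  | [], l => l
  | l, [] => l
  | a :: l, b :: l' => (a + b) :: coeffAdd l l'

/-- Product of polynomials given by their coefficient lists. -/
def coeffMul : List ℕ → List ℕ → List ℕ
  | [], _ => []
  | a :: l, l' => coeffAdd (l'.map (a * ·)) (0 :: coeffMul l l')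

/-- The polynomial with a given coefficient list. -/
noncomputable def ofCoeffs (l : List ℕ) : ℚ[X] := l.foldr (fun a p => C (a : ℚ) + X * p) 0

theorem ofCoeffs_nil : ofCoeffs [] = 0 := rfl

theorem ofCoeffs_cons (a : ℕ) (l : List ℕ) : ofCoeffs (a :: l) = C (a : ℚ) + X * ofCoeffs l := rfl

theorem ofCoeffs_coeffAdd (l l' : List ℕ) :
    ofCoeffs (coeffAdd l l') = ofCoeffs l + ofCoeffs l' := by
  induction l, l' using coeffAdd.induct with
  | case1 l => simp [coeffAdd, ofCoeffs_nil]
  | case2 l h => cases l <;> simp [coeffAdd, ofCoeffs_nil]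
  | case3 a l b l' ih =>
    simp only [coeffAdd, ofCoeffs_cons, ih, Nat.cast_add, map_add]
    ring

theorem ofCoeffs_map_mul (a : ℕ) (l : List ℕ) :
    ofCoeffs (l.map (a * ·)) = C (a : ℚ) * ofCoeffs l := by
  induction l with
  | nil => simp [ofCoeffs_nil]
  | cons b l ih =>
    simp only [List.map_cons, ofCoeffs_cons, ih, Nat.cast_mul, map_mul]
    ring

theorem ofCoeffs_coeffMul (l l' : List ℕ) :
    ofCoeffs (coeffMul l l') = ofCoeffs l * ofCoeffs l' := by
  induction l with
  | nil => simp [coeffMul, ofCoeffs_nil]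
  | cons a l ih =>
    simp only [coeffMul, ofCoeffs_coeffAdd, ofCoeffs_map_mul, ofCoeffs_cons, ih, Nat.cast_zero,
      map_zero]
    ring

theorem ofCoeffs_replicate (n : ℕ) :
    ofCoeffs (List.replicate n 1) = ∑ i ∈ Finset.range n, X ^ i := by
  induction n with
  | zero => simp [ofCoeffs_nil]
  | succ n ih =>
    rw [List.replicate_succ, ofCoeffs_cons, ih, Finset.sum_range_succ', Finset.mul_sum]
    simp [pow_succ', add_comm]

theorem ofCoeffs_monomial (n : ℕ) : ofCoeffs (List.replicate n 0 ++ [1]) = X ^ n := by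
  induction n with
  | zero => simp [ofCoeffs_nil, ofCoeffs_cons]
  | succ n ih =>
    rw [List.replicate_succ, List.cons_append, ofCoeffs_cons, ih, pow_succ']
    simp

/-- The coefficients of the product of the polynomials `1 + q + ⋯ + q ^ (n - 1)`. -/
def coeffProd (l : List ℕ) : List ℕ :=
  l.foldr (fun n p => coeffMul (List.replicate n 1) p) [1]

theorem ofCoeffs_coeffProd (l : List ℕ) :
    ofCoeffs (coeffProd l) = (l.map fun n => ∑ i ∈ Finset.range n, (X : ℚ[X]) ^ i).prod := by
  induction l with
  | nil => simp [coeffProd, ofCoeffs_nil, ofCoeffs_cons]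
  | cons a l ih =>
    rw [List.map_cons, List.prod_cons, ← ih, ← ofCoeffs_replicate, ← ofCoeffs_coeffMul]
    rfl

/-- The coefficients of a sum of monomials. -/
def coeffCount (l : List ℕ) : List ℕ :=
  l.foldr (fun n p => coeffAdd (List.replicate n 0 ++ [1]) p) []

theorem ofCoeffs_coeffCount (l : List ℕ) :
    ofCoeffs (coeffCount l) = (l.map fun n => (X : ℚ[X]) ^ n).sum := by
  induction l with
  | nil => simp [coeffCount, ofCoeffs_nil]
  | cons a l ih =>
    rw [List.map_cons, List.sum_cons, ← ih, ← ofCoeffs_monomial, ← ofCoeffs_coeffAdd]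
    rfl

theorem coeffMul_coeffCount : ∀ m < 127, 0 < m →
    coeffMul (coeffCount ((orbitList m).map Prod.snd)) (coeffProd (degs (m ^^^ 2 ^ (leaf m : ℕ))))
      = coeffProd (degs m) := by
  decide +kernel

theorem degs_zero : degs 0 = [] := by decide

theorem parabolic_empty {W : Type*} [Group W] {Mat : CoxeterMatrix (Fin 7)}
    (cs : CoxeterSystem Mat W) : parabolic cs ∅ = ⊥ := by
  simp [parabolic]

/-- Poincaré polynomials of the finite standard parabolic subgroups in type affine `E₆`. -/
theorem finite_and_poin_ofMask {W : Type*} [Group W] {Mat : CoxeterMatrix (Fin 7)}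
    (cs : CoxeterSystem Mat W) (hM : IsAffineE6 Mat) (m : ℕ) (hm : m < 127) :
    (parabolic cs (ofMask m) : Set W).Finite ∧
      poin cs (ofMask m) = ((degs m).map fun n => ∑ i ∈ Finset.range n, (X : ℚ[X]) ^ i).prod := by
  induction m using Nat.strong_induction_on with
  | _ m ih =>
    rcases Nat.eq_zero_or_pos m with rfl | h0
    · have e : ofMask 0 = ∅ := by decide
      have hf : (parabolic cs (ofMask 0) : Set W).Finite := by
        rw [e, parabolic_empty, Subgroup.coe_bot]
        exact Set.finite_singleton _
      refine ⟨hf, ?_⟩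
      rw [poin_of_finite cs hf, e, parabolic_empty, Subgroup.coe_bot, finsum_mem_singleton,
        degs_zero]
      simp
    · have hlt := xor_leaf_lt m hm h0
      obtain ⟨hf, hp⟩ := ih _ hlt (hlt.trans hm)
      rw [← ofMask_erase (testBit_leaf m hm h0)] at hf hp
      have h := finite_and_poin_eq_of_isOrbitList cs hM (isOrbitList_orbitList hm h0) hf
      refine ⟨h.1, ?_⟩
      rw [h.2, hp, ← ofCoeffs_coeffProd, ← ofCoeffs_coeffProd, ← coeffMul_coeffCount m hm h0,
        ofCoeffs_coeffMul, ofCoeffs_coeffCount, List.map_map]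
      rfl

end Masks

section SparseVectors

/-- Finitely supported integer vectors, as lists of pairs of an index and a coefficient. -/
abbrev SparseVec := List (ℕ × ℤ)

/-- The free `R`-module on the natural numbers. -/
abbrev FreeMod : Type := ℕ →₀ R

/-- The element of the free module represented by a sparse vector. -/
noncomputable def toFree (l : SparseVec) : FreeMod :=
  (l.map fun p => Finsupp.single p.1 (p.2 : R)).sum

theorem toFree_nil : toFree [] = 0 := rfl

theorem toFree_cons (p : ℕ × ℤ) (l : SparseVec) :
    toFree (p :: l) = Finsupp.single p.1 (p.2 : R) + toFree l := by
  simp [toFree]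

theorem toFree_append (l l' : SparseVec) : toFree (l ++ l') = toFree l + toFree l' := by
  simp [toFree]

theorem toFree_flatMap {α : Type*} (l : List α) (f : α → SparseVec) :
    toFree (l.flatMap f) = (l.map fun a => toFree (f a)).sum := by
  induction l with
  | nil => simp [toFree_nil]
  | cons a l ih => simp [List.flatMap_cons, toFree_append, ih]

/-- Scalar multiplication of sparse vectors. -/
def scaleVec (a : ℤ) (l : SparseVec) : SparseVec :=
  if a = 0 then [] else l.map fun p => (p.1, a * p.2)

theorem toFree_scaleVec (a : ℤ) (l : SparseVec) :
    toFree (scaleVec a l) = (a : R) • toFree l := by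
  rw [scaleVec]
  split_ifs with h
  · simp [h, toFree_nil]
  · induction l with
    | nil => simp [toFree_nil]
    | cons p l ih =>
      rw [List.map_cons, toFree_cons, toFree_cons, ih, smul_add, Finsupp.smul_single, smul_eq_mul,
        Int.cast_mul]

/-- The coefficient of a sparse vector at an index. -/
def coefAt (l : SparseVec) (i : ℕ) : ℤ := l.foldr (fun p a => if p.1 = i then p.2 + a else a) 0

theorem toFree_apply (l : SparseVec) (i : ℕ) : toFree l i = (coefAt l i : R) := by
  induction l with
  | nil => simp [coefAt, toFree_nil]
  | cons p l ih =>
    have h : coefAt (p :: l) i = if p.1 = i then p.2 + coefAt l i else coefAt l i := rfl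
    rw [toFree_cons, Finsupp.add_apply, ih, h, Finsupp.single_apply]
    split_ifs <;> simp

/-- Add a term to a sparse vector, collecting coefficients. -/
def addTerm (p : ℕ × ℤ) : SparseVec → SparseVec
  | [] => if p.2 = 0 then [] else [p]
  | r :: l =>
    if r.1 = p.1 then (if r.2 + p.2 = 0 then l else (r.1, r.2 + p.2) :: l) else r :: addTerm p l

theorem toFree_addTerm (p : ℕ × ℤ) (l : SparseVec) :
    toFree (addTerm p l) = Finsupp.single p.1 (p.2 : R) + toFree l := by
  induction l with
  | nil =>
    rw [addTerm]
    split_ifs with h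
    · simp [h, toFree_nil]
    · rw [toFree_cons]
  | cons r l ih =>
    rw [addTerm, toFree_cons]
    split_ifs with h h'
    · rw [← add_assoc, ← h, ← Finsupp.single_add, add_comm (p.2 : R), ← Int.cast_add, h']
      simp
    · rw [toFree_cons, ← add_assoc, ← h, ← Finsupp.single_add, add_comm (p.2 : R), Int.cast_add]
    · rw [toFree_cons, ih, add_left_comm]

/-- Collect equal indices of a sparse vector. -/
def collect (l : SparseVec) : SparseVec := l.foldr addTerm []

theorem toFree_collect (l : SparseVec) : toFree (collect l) = toFree l := by
  induction l with
  | nil => rfl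
  | cons p l ih =>
    have h : collect (p :: l) = addTerm p (collect l) := rfl
    rw [h, toFree_addTerm, ih, toFree_cons]

section Strictness

variable {α : Sort*}

/-- Evaluation of a natural number before passing it to a function. -/
def forceNat (n : ℕ) (f : ℕ → α) : α :=
  match n with
  | 0 => f 0
  | k + 1 => f (Nat.succ k)

theorem forceNat_eq (n : ℕ) (f : ℕ → α) : forceNat n f = f n := by cases n <;> rfl

/-- Evaluation of an integer before passing it to a function. -/
def forceInt (n : ℤ) (f : ℤ → α) : α :=
  match n with
  | .ofNat k => forceNat k fun k => f (.ofNat k)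
  | .negSucc k => forceNat k fun k => f (.negSucc k)

theorem forceInt_eq (n : ℤ) (f : ℤ → α) : forceInt n f = f n := by
  cases n with
  | ofNat k => exact forceNat_eq k fun k => f (.ofNat k)
  | negSucc k => exact forceNat_eq k fun k => f (.negSucc k)

/-- Evaluation of a sparse vector before passing it to a function. -/
def forceVec (l : SparseVec) (f : SparseVec → α) : α :=
  match l with
  | [] => f []
  | p :: l => forceNat p.1 fun a => forceInt p.2 fun b => forceVec l fun l' => f ((a, b) :: l')

theorem forceVec_eq (l : SparseVec) (f : SparseVec → α) : forceVec l f = f l := by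
  induction l generalizing f with
  | nil => rfl
  | cons p l ih => rw [forceVec, forceNat_eq, forceInt_eq, ih]

end Strictness

/-- The linear endomorphism with given columns. -/
noncomputable def colMap (col : ℕ → SparseVec) : FreeMod →ₗ[R] FreeMod :=
  Finsupp.linearCombination R fun i => toFree (col i)

/-- Apply the endomorphism with given columns to a sparse vector. -/
def applyCol (col : ℕ → SparseVec) (l : SparseVec) : SparseVec :=
  forceVec (l.flatMap fun p => scaleVec p.2 (col p.1)) fun l' => forceVec (collect l') id

theorem colMap_single (col : ℕ → SparseVec) (i : ℕ) :
    colMap col (Finsupp.single i 1) = toFree (col i) := by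
  simp [colMap]

theorem colMap_toFree (col : ℕ → SparseVec) (l : SparseVec) :
    colMap col (toFree l) = toFree (applyCol col l) := by
  rw [applyCol, forceVec_eq, forceVec_eq, id, toFree_collect]
  induction l with
  | nil => simp [toFree_nil]
  | cons p l ih =>
    rw [toFree_cons, map_add, ih, List.flatMap_cons, toFree_append, toFree_scaleVec]
    simp [colMap]

theorem toFree_singleton (i : ℕ) : toFree [(i, 1)] = Finsupp.single i 1 := by
  simp [toFree]

/-- The submodule of vectors whose coefficients are divisible by given weights. -/
noncomputable def weightLattice (w : ℕ → R) : Submodule R FreeMod where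
  carrier := {z | ∀ i, w i ∣ z i}
  add_mem' ha hb i := dvd_add (ha i) (hb i)
  zero_mem' _ := dvd_zero _
  smul_mem' c _ hz i := Dvd.dvd.mul_left (hz i) c

theorem smul_toFree_mem_weightLattice {w : ℕ → R} {a : R} {l : SparseVec}
    (h : ∀ p ∈ l, w p.1 ∣ a) : a • toFree l ∈ weightLattice w := by
  induction l with
  | nil => simp [toFree_nil]
  | cons p l ih =>
    rw [toFree_cons, smul_add]
    refine add_mem ?_ (ih fun r hr => h r (List.mem_cons_of_mem _ hr))
    intro i
    rw [Finsupp.smul_apply, smul_eq_mul, Finsupp.single_apply]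
    split_ifs with e
    · exact e ▸ (h p List.mem_cons_self).mul_right _
    · simp

theorem linear_mem_of_mem_weightLattice {E : Type*} [AddCommGroup E] [Module R E] {w : ℕ → R}
    (T : FreeMod →ₗ[R] E) (P : Submodule R E)
    (h : ∀ i, ∀ a, w i ∣ a → a • T (Finsupp.single i 1) ∈ P) {z : FreeMod}
    (hz : z ∈ weightLattice w) : T z ∈ P := by
  have e : z = z.sum fun i a => a • Finsupp.single i (1 : R) := by
    conv_lhs => rw [← Finsupp.sum_single z]
    exact Finsupp.sum_congr fun i _ => by simp
  rw [e, Finsupp.sum, map_sum]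
  refine P.sum_mem fun i _ => ?_
  rw [map_smul]
  exact h i _ (hz i)

end SparseVectors

section Contraction

/-- The number of vertices encoded by `m < 128`, read off from a table of octal digits. -/
def popCount (m : ℕ) : ℕ :=
  38688605477795291639177638255174619524745213742638081737860757693208305674782301095493395244431646846014899907793992
    >>> (3 * m) % 8

/-- The incidence sign of the vertex `s` with respect to `m`, read off from a table of parities. -/
def incSign (m s : ℕ) : ℤ :=
  if Nat.testBit 199931532107794273605284333428918544790 (m % 2 ^ s) then -1 else 1

/-- The columns of the simplicial boundary map. -/
def bdryCol (m : ℕ) : SparseVec :=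
  [0, 1, 2, 3, 4, 5, 6].flatMap fun s =>
    if m.testBit s then [(m ^^^ 2 ^ s, incSign m s)] else []

/-- The octal digits of these numbers are the values of `cycMult d`. -/
def cycTable : ℕ → ℕ
  | 2 => 2814255179436948609420329746088810054024438690471240901378531242224822264260823311097309636471507070930675986633800
  | 3 => 2090187092531572949578777854210531689986245532466966604294173810488310391287023289468622839528019549478549366800384
  | 4 => 1405840274097062599731705514320802264611166481940703067598261905693645333802277640823280178006702547726649375326208
  | 5 => 703607253425133606791051733587371200539017064461280300485877403699614624996190934017251834060371376079688806957056
  | 6 => 1396199469443532837356681166337755499249259406418671902752581491919448155821795724077272038652552336179813744115712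
  | 8 => 702233020590038325804777814284786085881548087583978907901340636211768435274750116127049490672266264003528036974592
  | 9 => 692613390170996704903342501760336961417417291863650429710813232713430163110078878956667357313661702179112011956224
  | 12 => 692613390170996704903342501760336961417417291863650429710813232713430163110078878956667357313661702179112011956224
  | _ => 0

/-- The multiplicity of `Φ_d` in the Poincaré polynomial of the parabolic subgroup of `m`,
for `m < 127`. -/
def cycMult (d m : ℕ) : ℕ := cycTable d >>> (3 * m) % 8

/-- The columns of the operator that adds the vertex `s` if this preserves `cycMult d`. -/
def addCol (d s m : ℕ) : SparseVec :=
  if m.testBit s then []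
  else if m + 2 ^ s < 127 ∧ cycMult d (m + 2 ^ s) = cycMult d m then [(m + 2 ^ s, incSign m s)]
  else []

/-- The columns of the chain map `1 - ∂ V - V ∂` with `V` the operator adding `s`. -/
def contrCol (d s m : ℕ) : SparseVec :=
  forceVec (collect ((m, 1) :: scaleVec (-1) (applyCol bdryCol (addCol d s m) ++
    applyCol (addCol d s) (bdryCol m)))) id

/-- The order in which the vertices are processed. -/
def vertexOrder : ℕ → List ℕ
  | 2 => [5, 0, 3, 4, 6, 2, 1]
  | 3 => [6, 1, 0, 5, 3, 4, 2]
  | 4 => [6, 1, 5, 2, 4, 3, 0]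
  | 5 => [1, 6, 3, 0, 4, 2, 5]
  | 6 => [1, 6, 0, 5, 4, 3, 2]
  | 8 => [6, 4, 0, 2, 5, 3, 1]
  | _ => [0, 2, 4, 5, 3, 6, 1]

/-- Apply the successive contractions for `d` to a sparse vector. -/
def contractVec (d : ℕ) (l : SparseVec) : SparseVec :=
  (vertexOrder d).foldl (fun l s => applyCol (contrCol d s) l) l

/-- The data of a direct summand of the homology. -/
structure Bar where
  /-- The order of the cyclotomic polynomial. -/
  d : ℕ
  /-- The generator above. -/
  src : ℕ
  /-- The generator below. -/
  tgt : ℕ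
  /-- The sign making the relevant coefficient equal to one. -/
  sgn : ℤ

/-- The direct summands in degree `k`. -/
def barsAt : ℕ → List Bar
  | 0 => [⟨2, 1, 0, 1⟩]
  | 3 => [⟨3, 45, 19, -1⟩]
  | 4 => [⟨5, 61, 23, 1⟩, ⟨8, 61, 30, 1⟩]
  | 5 => [⟨2, 95, 31, -1⟩, ⟨3, 63, 31, -1⟩, ⟨3, 125, 109, -1⟩, ⟨3, 126, 110, -1⟩,
      ⟨6, 63, 62, 1⟩, ⟨6, 125, 124, 1⟩, ⟨9, 63, 62, 1⟩, ⟨9, 125, 94, 1⟩, ⟨12, 63, 62, 1⟩,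
      ⟨12, 125, 94, 1⟩]
  | _ => []

/-- All direct summands in degrees at most five. -/
def bars (d : ℕ) : List Bar := ((List.range 6).flatMap barsAt).filter fun x => x.d = d

/-- The chain attached to a direct summand. -/
def Bar.chain (x : Bar) : SparseVec := scaleVec x.sgn (contractVec x.d [(x.src, 1)])

/-- The boundary of the chain attached to a direct summand. -/
def Bar.bdry (x : Bar) : SparseVec := applyCol bdryCol x.chain

/-- The relevant orders of roots of unity. -/
def orders : List ℕ := [2, 3, 4, 5, 6, 8, 9, 12]

theorem cycMult_eq : ∀ d ∈ orders, ∀ m < 127,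
    cycMult d m = (degs m).countP fun n => decide (d ∣ n) := by decide +kernel

theorem popCount_eq : ∀ m < 128, popCount m = (ofMask m).card := by decide +kernel

theorem incSign_eq : ∀ m < 128, ∀ s : Fin 7,
    incSign m s = (-1) ^ ((ofMask m).filter fun t => t < s).card := by decide +kernel

theorem bdry_bdryCol : ∀ m < 127, applyCol bdryCol (bdryCol m) = [] := by decide +kernel

theorem bdryCol_valid : ∀ m < 127, ∀ p ∈ bdryCol m, p.1 < 127 ∧ popCount p.1 + 1 = popCount m ∧
    ∀ d ∈ orders, cycMult d p.1 ≤ cycMult d m := by decide +kernel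

theorem addCol_valid : ∀ d ∈ orders, ∀ s < 7, ∀ m < 127, ∀ p ∈ addCol d s m,
    p.1 < 127 ∧ popCount p.1 = popCount m + 1 ∧ cycMult d p.1 ≤ cycMult d m := by decide +kernel

theorem cycMult_le : ∀ d ∈ orders, ∀ m < 127, cycMult d m ≤ 4 := by decide +kernel

/-- The difference of the two sides of the identity expressing that the contractions split off
the direct summands, where `u` and `v` are the contractions of the generator `m` and of its
boundary. -/
def contractDefect (d : ℕ) (u v : SparseVec) : SparseVec :=
  collect (u ++ scaleVec (-1) ((bars d).flatMap fun x =>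
    scaleVec (coefAt u x.tgt) x.bdry ++ scaleVec (coefAt v x.tgt) x.chain))

/-- The properties of the contraction at the generator `m`. -/
def contractCheck (d m : ℕ) : Bool :=
  forceVec (contractVec d [(m, 1)]) fun u => forceVec (contractVec d (bdryCol m)) fun v =>
    decide (popCount m ≤ 5 → contractDefect d u v = []) &&
    decide (∀ x ∈ bars d,
      (coefAt u x.tgt = 0 ∨ (popCount m = popCount x.tgt ∧ cycMult d x.tgt ≤ cycMult d m)) ∧
      (coefAt v x.tgt = 0 ∨ cycMult d x.tgt + 1 ≤ cycMult d m))

/-- The properties of the chain of a direct summand. -/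
def Bar.check (x : Bar) : Bool :=
  forceVec x.chain fun c => forceVec (applyCol bdryCol c) fun b =>
    decide (∀ p ∈ c, p.1 < 127 ∧ popCount p.1 = popCount x.tgt + 1 ∧
      cycMult x.d p.1 ≤ cycMult x.d x.tgt + 1) &&
    decide (∀ p ∈ b, p.1 < 127 ∧ popCount p.1 = popCount x.tgt ∧
      cycMult x.d p.1 ≤ cycMult x.d x.tgt)

theorem contractCheck_eq_true : ∀ d ∈ orders, ∀ m < 127, contractCheck d m = true := by
  decide +kernel

theorem Bar.check_eq_true : ∀ d ∈ orders, ∀ x ∈ bars d, x.check = true := by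
  decide +kernel

theorem coefAt_bdry : ∀ k < 6, ∀ i j : Fin (barsAt k).length,
    ((barsAt k).get i).d = ((barsAt k).get j).d →
    coefAt (contractVec ((barsAt k).get j).d ((barsAt k).get i).bdry) ((barsAt k).get j).tgt =
      if i = j then 1 else 0 := by
  decide +kernel

end Contraction

section Weights

/-- The set of relevant orders of roots of unity. -/
def orderSet : Finset ℕ := {2, 3, 4, 5, 6, 8, 9, 12}

theorem mem_orders {d : ℕ} : d ∈ orders ↔ d ∈ orderSet := by simp [orders, orderSet]

theorem degs_subset : ∀ m < 127, ∀ n ∈ degs m, n ∈ orderSet := by decide +kernel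

theorem divisors_erase_one : ∀ n ∈ orderSet, n.divisors.erase 1 = orderSet.filter (· ∣ n) := by
  decide +kernel

theorem geom_sum_eq_prod_cyclotomic {n : ℕ} (hn : n ∈ orderSet) :
    ∑ i ∈ Finset.range n, (X : ℚ[X]) ^ i =
      ∏ d ∈ orderSet, if d ∣ n then cyclotomic d ℚ else 1 := by
  have h0 : 0 < n := by
    rw [orderSet] at hn
    simp only [Finset.mem_insert, Finset.mem_singleton] at hn
    omega
  rw [← prod_cyclotomic_eq_geom_sum h0, divisors_erase_one n hn, Finset.prod_filter]

/-- The Poincaré polynomial of the parabolic subgroup encoded by `m`, as an element of `R`. -/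
noncomputable def weight (m : ℕ) : R := ∏ d ∈ orderSet, cyc d ^ cycMult d m

theorem prod_geom_sum_eq {l : List ℕ} (hl : ∀ n ∈ l, n ∈ orderSet) :
    (l.map fun n => ∑ i ∈ Finset.range n, (X : ℚ[X]) ^ i).prod =
      ∏ d ∈ orderSet, cyclotomic d ℚ ^ l.countP fun n => decide (d ∣ n) := by
  induction l with
  | nil => simp
  | cons n l ih =>
    rw [List.map_cons, List.prod_cons, ih fun k hk => hl k (List.mem_cons_of_mem _ hk),
      geom_sum_eq_prod_cyclotomic (hl n List.mem_cons_self), ← Finset.prod_mul_distrib]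
    refine Finset.prod_congr rfl fun d _ => ?_
    rw [List.countP_cons, pow_add, mul_comm]
    by_cases h : d ∣ n <;> simp [h]

variable {W : Type*} [Group W] {Mat : CoxeterMatrix (Fin 7)} (cs : CoxeterSystem Mat W)

theorem poin_ofMask (hM : IsAffineE6 Mat) {m : ℕ} (hm : m < 127) :
    poin cs (ofMask m) = ∏ d ∈ orderSet, cyclotomic d ℚ ^ cycMult d m := by
  rw [(finite_and_poin_ofMask cs hM m hm).2, prod_geom_sum_eq (degs_subset m hm)]
  exact Finset.prod_congr rfl fun d hd => by rw [cycMult_eq d (mem_orders.2 hd) m hm]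

theorem toLaurent_poin_ofMask (hM : IsAffineE6 Mat) {m : ℕ} (hm : m < 127) :
    toLaurent (poin cs (ofMask m)) = weight m := by
  rw [poin_ofMask cs hM hm, map_prod, weight]
  exact Finset.prod_congr rfl fun d _ => map_pow _ _ _

theorem cyc_ne_zero (d : ℕ) : cyc d ≠ 0 := fun h =>
  cyclotomic_ne_zero d ℚ (toLaurent_injective (by rw [map_zero]; exact h))

theorem isCoprime_cyc {d e : ℕ} (h : d ≠ e) : IsCoprime (cyc d) (cyc e) :=
  (cyclotomic.isCoprime_rat h).map toLaurent

theorem weight_ne_zero (m : ℕ) : weight m ≠ 0 :=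
  Finset.prod_ne_zero_iff.2 fun d _ => pow_ne_zero _ (cyc_ne_zero d)

/-- The binary encoding of a set of vertices. -/
def toMask (σ : Finset (Fin 7)) : ℕ := ∑ i ∈ σ, 2 ^ (i : ℕ)

theorem ofMask_toMask : ∀ σ, ofMask (toMask σ) = σ := by decide +kernel

theorem toMask_ofMask : ∀ m < 128, toMask (ofMask m) = m := by decide +kernel

theorem toMask_lt_iff : ∀ σ, toMask σ < 127 ↔ σ ≠ Finset.univ := by decide +kernel

theorem toMask_erase {σ : Finset (Fin 7)} {s : Fin 7} (hs : s ∈ σ) :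
    toMask (σ.erase s) = toMask σ ^^^ 2 ^ (s : ℕ) := by
  revert σ s
  decide +kernel

theorem toMask_injective : Function.Injective toMask :=
  Function.LeftInverse.injective ofMask_toMask

theorem finite_parabolic_iff (hM : IsAffineE6 Mat) (σ : Finset (Fin 7)) :
    (parabolic cs σ : Set W).Finite ↔ toMask σ < 127 := by
  constructor
  · intro h
    rw [toMask_lt_iff]
    rintro rfl
    have := infinite_affineE6 cs hM
    rw [parabolic, Finset.coe_univ, Set.image_univ, cs.subgroup_closure_range_simple,
      Subgroup.coe_top] at h
    exact Set.infinite_univ h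
  · intro h
    have := (finite_and_poin_ofMask cs hM _ h).1
    rwa [ofMask_toMask] at this

theorem card_eq_popCount {σ : Finset (Fin 7)} (h : toMask σ < 127) :
    σ.card = popCount (toMask σ) := by
  rw [popCount_eq _ (by omega), ofMask_toMask]

end Weights

section Embedding

/-- The simplicial boundary map on the free module. -/
noncomputable def bdryMap : FreeMod →ₗ[R] FreeMod := colMap bdryCol

theorem toFree_bdryCol (m : ℕ) : toFree (bdryCol m) =
    ∑ s : Fin 7, if m.testBit s then Finsupp.single (m ^^^ 2 ^ (s : ℕ)) (incSign m s : R) else 0 := by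
  have h : ∀ s : ℕ, toFree (if m.testBit s then [(m ^^^ 2 ^ s, incSign m s)] else []) =
      if m.testBit s then Finsupp.single (m ^^^ 2 ^ s) (incSign m s : R) else 0 := by
    intro s
    split_ifs
    · simp [toFree]
    · rfl
  rw [bdryCol, toFree_flatMap]
  simp only [h, Fin.sum_univ_seven, List.map_cons, List.map_nil, List.sum_cons, List.sum_nil]
  simp only [Fin.isValue, Fin.coe_ofNat_eq_mod, add_zero, add_assoc]

theorem erase_valid {m : ℕ} (hm : m < 127) {s : Fin 7} (hs : m.testBit s = true) :
    m ^^^ 2 ^ (s : ℕ) < 127 ∧ popCount (m ^^^ 2 ^ (s : ℕ)) + 1 = popCount m ∧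
      ∀ d ∈ orders, cycMult d (m ^^^ 2 ^ (s : ℕ)) ≤ cycMult d m := by
  refine bdryCol_valid m hm (m ^^^ 2 ^ (s : ℕ), incSign m s) ?_
  rw [bdryCol, List.mem_flatMap]
  refine ⟨s, ?_, by simp [hs]⟩
  fin_cases s <;> simp

variable {W : Type*} [Group W] {Mat : CoxeterMatrix (Fin 7)} (cs : CoxeterSystem Mat W)
  (hM : IsAffineE6 Mat)

theorem testBit_toMask {σ : Finset (Fin 7)} {s : Fin 7} :
    (toMask σ).testBit s = true ↔ s ∈ σ := by
  rw [← mem_ofMask, ofMask_toMask]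

include hM in
theorem toLaurent_div_mul_weight {σ : Finset (Fin 7)} (hσ : toMask σ < 127) {s : Fin 7}
    (hs : s ∈ σ) :
    toLaurent (poin cs σ / poin cs (σ.erase s)) * weight (toMask (σ.erase s)) =
      weight (toMask σ) := by
  obtain ⟨h1, -, h3⟩ := erase_valid hσ (testBit_toMask.2 hs)
  rw [← toMask_erase hs] at h1 h3
  have e1 := poin_ofMask cs hM hσ
  have e2 := poin_ofMask cs hM h1
  have e3 := toLaurent_poin_ofMask cs hM hσ
  have e4 := toLaurent_poin_ofMask cs hM h1
  rw [ofMask_toMask] at e1 e2 e3 e4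
  rw [← e3, ← e4, ← map_mul, mul_comm, EuclideanDomain.mul_div_cancel']
  · exact fun h => weight_ne_zero _ (by rw [← e4, h, map_zero])
  · rw [e1, e2]
    exact Finset.prod_dvd_prod_of_dvd _ _ fun d hd => pow_dvd_pow _ (h3 d (mem_orders.2 hd))

/-- The embedding of the weighted complex into the simplicial chain complex of the simplex. -/
noncomputable def embed (k : ℕ) : (KW cs k → R) →ₗ[R] FreeMod :=
  Fintype.linearCombination R fun σ : KW cs k =>
    Finsupp.single (toMask σ.1) (weight (toMask σ.1))

theorem embed_apply_toMask {k : ℕ} (y : KW cs k → R) (σ : KW cs k) :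
    embed cs k y (toMask σ.1) = y σ * weight (toMask σ.1) := by
  rw [embed, Fintype.linearCombination_apply, Finsupp.finsetSum_apply,
    Finset.sum_eq_single_of_mem σ (Finset.mem_univ _)]
  · simp
  · intro τ _ hτ
    have : toMask τ.1 ≠ toMask σ.1 := fun h => hτ (Subtype.ext (toMask_injective h))
    simp [this]

theorem embed_injective (k : ℕ) : Function.Injective (embed cs k) := by
  intro y y' h
  ext σ : 1
  have := congrArg (fun z => z (toMask σ.1)) h
  simp only [embed_apply_toMask] at this
  exact mul_right_cancel₀ (weight_ne_zero _) this

include hM in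
theorem bcoeff_mul_weight {σ : Finset (Fin 7)} (hσ : toMask σ < 127) (τ : Finset (Fin 7)) :
    bcoeff cs σ τ * weight (toMask τ) = ∑ s ∈ σ, if τ = σ.erase s then
      (incSign (toMask σ) s : R) * weight (toMask σ) else 0 := by
  rw [bcoeff, Finset.sum_mul]
  refine Finset.sum_congr rfl fun s hs => ?_
  split_ifs with h
  · rw [h, mul_assoc, toLaurent_div_mul_weight cs hM hσ hs, incSign_eq _ (by omega), ofMask_toMask]
    push_cast
    rfl
  · rw [zero_mul]

include hM in
theorem embed_bdry (k : ℕ) (y : KW cs (k + 1) → R) :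
    embed cs k (bdry cs k y) = bdryMap (embed cs (k + 1) y) := by
  suffices h : embed cs k ∘ₗ bdry cs k = bdryMap ∘ₗ embed cs (k + 1) from LinearMap.congr_fun h y
  refine LinearMap.pi_ext fun σ a => ?_
  have hσ := (finite_parabolic_iff cs hM _).1 σ.2.2
  have e1 : embed cs (k + 1) (Pi.single σ a) =
      (a * weight (toMask σ.1)) • Finsupp.single (toMask σ.1) 1 := by
    rw [embed, Fintype.linearCombination_apply_single]
    simp
  have e2 : bdry cs k (Pi.single σ a) = fun τ => bcoeff cs σ.1 τ.1 * a := by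
    ext τ : 1
    simp [bdry]
  rw [LinearMap.comp_apply, LinearMap.comp_apply, e1, e2, map_smul, bdryMap, colMap_single,
    toFree_bdryCol, embed, Fintype.linearCombination_apply]
  have e3 : ∀ τ : KW cs k, (bcoeff cs σ.1 τ.1 * a) •
      (Finsupp.single (toMask τ.1) (weight (toMask τ.1)) : FreeMod) =
      ∑ s ∈ σ.1, if τ.1 = σ.1.erase s then (a * weight (toMask σ.1)) •
        Finsupp.single (toMask (σ.1.erase s)) (incSign (toMask σ.1) s : R) else 0 := by
    intro τ
    rw [Finsupp.smul_single, smul_eq_mul, mul_right_comm, bcoeff_mul_weight cs hM hσ,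
      Finset.sum_mul, Finsupp.single_finsetSum]
    refine Finset.sum_congr rfl fun s _ => ?_
    split_ifs with h
    · rw [Finsupp.smul_single, h, smul_eq_mul]
      congr 1
      ring
    · simp
  rw [Finset.sum_congr rfl fun τ _ => e3 τ, Finset.sum_comm, Finset.smul_sum]
  have e4 : ∀ s ∈ σ.1, (∑ τ : KW cs k, if τ.1 = σ.1.erase s then (a * weight (toMask σ.1)) •
        (Finsupp.single (toMask (σ.1.erase s)) (incSign (toMask σ.1) s : R) : FreeMod) else 0) =
      (a * weight (toMask σ.1)) •
        Finsupp.single (toMask (σ.1.erase s)) (incSign (toMask σ.1) s : R) := by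
    intro s hs
    have hc : (σ.1.erase s).card = k := by rw [Finset.card_erase_of_mem hs, σ.2.1]; rfl
    have hf : (parabolic cs (σ.1.erase s) : Set W).Finite := by
      rw [finite_parabolic_iff cs hM, toMask_erase hs]
      exact (erase_valid hσ (testBit_toMask.2 hs)).1
    rw [Finset.sum_eq_single_of_mem (⟨σ.1.erase s, hc, hf⟩ : KW cs k) (Finset.mem_univ _)]
    · simp
    · intro τ _ hτ
      rw [if_neg fun h => hτ (Subtype.ext h)]
  rw [Finset.sum_congr rfl e4, ← Finset.sum_subset (Finset.subset_univ σ.1)]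
  · refine Finset.sum_congr rfl fun s hs => ?_
    rw [if_pos (testBit_toMask.2 hs), toMask_erase hs]
  · intro s _ hs
    rw [if_neg fun h => hs (testBit_toMask.1 h), smul_zero]

/-- The weights `w` on the generators of degree `k`, and zero elsewhere. -/
noncomputable def degWeight (w : ℕ → R) (k m : ℕ) : R :=
  if m < 127 ∧ popCount m = k then w m else 0

include hM in
theorem embed_mem (k : ℕ) (y : KW cs k → R) :
    embed cs k y ∈ weightLattice (degWeight weight k) := by
  rw [embed, Fintype.linearCombination_apply]
  refine Submodule.sum_mem _ fun σ _ => Submodule.smul_mem _ _ fun m => ?_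
  rw [Finsupp.single_apply]
  split_ifs with h
  · have hσ := (finite_parabolic_iff cs hM _).1 σ.2.2
    rw [degWeight, ← h, if_pos ⟨hσ, by rw [← card_eq_popCount hσ, σ.2.1]⟩]
  · exact dvd_zero _

include hM in
theorem exists_embed_eq {k : ℕ} {z : FreeMod} (hz : z ∈ weightLattice (degWeight weight k)) :
    ∃ y, embed cs k y = z := by
  have h : ∀ σ : KW cs k, ∃ a, z (toMask σ.1) = a * weight (toMask σ.1) := by
    intro σ
    have hσ := (finite_parabolic_iff cs hM _).1 σ.2.2
    have := hz (toMask σ.1)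
    rw [degWeight, if_pos ⟨hσ, by rw [← card_eq_popCount hσ, σ.2.1]⟩] at this
    obtain ⟨a, ha⟩ := this
    exact ⟨a, by rw [ha, mul_comm]⟩
  choose y hy using h
  refine ⟨y, Finsupp.ext fun m => ?_⟩
  by_cases hm : m < 127 ∧ popCount m = k
  · have hf : (parabolic cs (ofMask m) : Set W).Finite := (finite_and_poin_ofMask cs hM m hm.1).1
    have e := embed_apply_toMask cs y ⟨ofMask m, by rw [← popCount_eq _ (by omega), hm.2], hf⟩
    rw [← hy] at e
    simpa only [toMask_ofMask m (by omega)] using e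
  · have h1 := hz m
    have h2 := embed_mem cs hM k y m
    rw [degWeight, if_neg hm, zero_dvd_iff] at h1 h2
    rw [h1, h2]

end Embedding

section Splitting

/-- The chains of degree `k` whose coefficients are divisible by the `Φ_d`-part of the weights. -/
noncomputable abbrev cycLattice (d k : ℕ) : Submodule R FreeMod :=
  weightLattice (degWeight (fun m => cyc d ^ cycMult d m) k)

theorem map_mem_of_mem_degWeight {E : Type*} [AddCommGroup E] [Module R E] {w : ℕ → R} {k : ℕ}
    (T : FreeMod →ₗ[R] E) (P : Submodule R E)
    (h : ∀ m < 127, popCount m = k → ∀ a, w m ∣ a → a • T (Finsupp.single m 1) ∈ P)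
    {z : FreeMod} (hz : z ∈ weightLattice (degWeight w k)) : T z ∈ P := by
  refine linear_mem_of_mem_weightLattice T P (fun m a ha => ?_) hz
  rw [degWeight] at ha
  split_ifs at ha with hm
  · exact h m hm.1 hm.2 a ha
  · rw [zero_dvd_iff.1 ha, zero_smul]
    exact P.zero_mem

theorem smul_toFree_mem_cycLattice {d k : ℕ} {a : R} {l : SparseVec}
    (h : ∀ p ∈ l, p.1 < 127 ∧ popCount p.1 = k ∧ cyc d ^ cycMult d p.1 ∣ a) :
    a • toFree l ∈ cycLattice d k := by
  refine smul_toFree_mem_weightLattice fun p hp => ?_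
  rw [degWeight, if_pos ⟨(h p hp).1, (h p hp).2.1⟩]
  exact (h p hp).2.2

theorem colMap_mem_cycLattice {d k k' : ℕ} {col : ℕ → SparseVec}
    (h : ∀ m < 127, popCount m = k → ∀ p ∈ col m,
      p.1 < 127 ∧ popCount p.1 = k' ∧ cycMult d p.1 ≤ cycMult d m)
    {z : FreeMod} (hz : z ∈ cycLattice d k) : colMap col z ∈ cycLattice d k' := by
  refine map_mem_of_mem_degWeight _ _ (fun m hm hk a ha => ?_) hz
  rw [colMap_single]
  refine smul_toFree_mem_cycLattice fun p hp => ?_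
  obtain ⟨h1, h2, h3⟩ := h m hm hk p hp
  exact ⟨h1, h2, (pow_dvd_pow _ h3).trans ha⟩

theorem bdryMap_mem_cycLattice {d k : ℕ} (hd : d ∈ orders) {z : FreeMod}
    (hz : z ∈ cycLattice d (k + 1)) : bdryMap z ∈ cycLattice d k := by
  refine colMap_mem_cycLattice (fun m hm hk p hp => ?_) hz
  obtain ⟨h1, h2, h3⟩ := bdryCol_valid m hm p hp
  exact ⟨h1, by omega, h3 d hd⟩

theorem bdryMap_bdryMap {w : ℕ → R} {k : ℕ} {z : FreeMod}
    (hz : z ∈ weightLattice (degWeight w k)) : bdryMap (bdryMap z) = 0 := by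
  have := map_mem_of_mem_degWeight (bdryMap ∘ₗ bdryMap) ⊥ (fun m hm _ a _ => ?_) hz
  · simpa using this
  · rw [LinearMap.comp_apply, bdryMap, colMap_single, colMap_toFree, bdry_bdryCol m hm, toFree_nil,
      smul_zero]
    exact Submodule.zero_mem _

theorem bdryMap_eq_zero {w : ℕ → R} {z : FreeMod}
    (hz : z ∈ weightLattice (degWeight w 0)) : bdryMap z = 0 := by
  have := map_mem_of_mem_degWeight bdryMap ⊥ (fun m hm hk a _ => ?_) hz
  · simpa using this
  · have : bdryCol m = [] := by
      refine List.eq_nil_iff_forall_not_mem.2 fun p hp => ?_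
      have := (bdryCol_valid m hm p hp).2.1
      omega
    rw [bdryMap, colMap_single, this, toFree_nil, smul_zero]
    exact Submodule.zero_mem _

/-- The operator adding the vertex `s`. -/
noncomputable def addMap (d s : ℕ) : FreeMod →ₗ[R] FreeMod := colMap (addCol d s)

/-- The chain map homotopic to the identity defined by `addMap d s`. -/
noncomputable def contrMap (d s : ℕ) : FreeMod →ₗ[R] FreeMod := colMap (contrCol d s)

theorem contrMap_apply (d s : ℕ) (z : FreeMod) :
    contrMap d s z = z - (bdryMap (addMap d s z) + addMap d s (bdryMap z)) := by
  suffices h : contrMap d s =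
      LinearMap.id - (bdryMap ∘ₗ addMap d s + addMap d s ∘ₗ bdryMap) from LinearMap.congr_fun h z
  refine Finsupp.lhom_ext' fun m => LinearMap.ext_ring ?_
  simp only [LinearMap.comp_apply, Finsupp.lsingle_apply, LinearMap.sub_apply, LinearMap.add_apply,
    LinearMap.id_apply, contrMap, addMap, bdryMap, colMap_single, colMap_toFree]
  rw [contrCol, forceVec_eq, id, toFree_collect, toFree_cons, toFree_scaleVec, toFree_append]
  simp [sub_eq_add_neg, add_comm]

/-- The composition of the maps `contrMap d s` for `s` in a list. -/
noncomputable def contractList (d : ℕ) : List ℕ → FreeMod →ₗ[R] FreeMod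
  | [] => LinearMap.id
  | s :: o => contractList d o ∘ₗ contrMap d s

/-- The composition of all the maps `contrMap d s`. -/
noncomputable def contractMap (d : ℕ) : FreeMod →ₗ[R] FreeMod := contractList d (vertexOrder d)

theorem contractMap_toFree (d : ℕ) (l : SparseVec) :
    contractMap d (toFree l) = toFree (contractVec d l) := by
  have h : ∀ (o : List ℕ) (l : SparseVec), contractList d o (toFree l) =
      toFree (o.foldl (fun l s => applyCol (contrCol d s) l) l) := by
    intro o
    induction o with
    | nil => intro l; rfl
    | cons s o ih =>
      intro l
      rw [contractList, LinearMap.comp_apply, contrMap, colMap_toFree, ih, List.foldl_cons]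
  exact h _ l

theorem contractMap_single (d m : ℕ) :
    contractMap d (Finsupp.single m 1) = toFree (contractVec d [(m, 1)]) := by
  rw [← toFree_singleton, contractMap_toFree]

theorem contractMap_bdryMap_single (d m : ℕ) :
    contractMap d (bdryMap (Finsupp.single m 1)) = toFree (contractVec d (bdryCol m)) := by
  rw [bdryMap, colMap_single, contractMap_toFree]

theorem vertexOrder_lt : ∀ d ∈ orders, ∀ s ∈ vertexOrder d, s < 7 := by decide

theorem exists_sub_contractMap_eq {d k : ℕ} (hd : d ∈ orders) {z : FreeMod}
    (hz : z ∈ cycLattice d k) (h0 : bdryMap z = 0) :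
    ∃ x ∈ cycLattice d (k + 1), z - contractMap d z = bdryMap x := by
  have h : ∀ (o : List ℕ), (∀ s ∈ o, s < 7) → ∀ z ∈ cycLattice d k, bdryMap z = 0 →
      ∃ x ∈ cycLattice d (k + 1), z - contractList d o z = bdryMap x := by
    intro o
    induction o with
    | nil => exact fun _ z _ _ => ⟨0, Submodule.zero_mem _, by simp [contractList]⟩
    | cons s o ih =>
      intro ho z hz h0
      have ha : addMap d s z ∈ cycLattice d (k + 1) := by
        refine colMap_mem_cycLattice (fun m hm hk p hp => ?_) hz
        obtain ⟨h1, h2, h3⟩ := addCol_valid d hd s (ho s List.mem_cons_self) m hm p hp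
        exact ⟨h1, by omega, h3⟩
      have e : contrMap d s z = z - bdryMap (addMap d s z) := by
        rw [contrMap_apply, h0, map_zero, add_zero]
      obtain ⟨x, hx, hx'⟩ := ih (fun t ht => ho t (List.mem_cons_of_mem _ ht)) (contrMap d s z)
        (e ▸ sub_mem hz (bdryMap_mem_cycLattice hd ha))
        (by rw [e, map_sub, h0, bdryMap_bdryMap ha, sub_zero])
      refine ⟨x + addMap d s z, add_mem hx ha, ?_⟩
      rw [map_add, ← hx', e, contractList, LinearMap.comp_apply, e]
      abel
  exact h _ (vertexOrder_lt d hd) z hz h0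

theorem sum_map_linearMap_apply {α : Type*} (l : List α) (f : α → FreeMod →ₗ[R] FreeMod)
    (z : FreeMod) : (l.map f).sum z = (l.map fun a => f a z).sum := by
  induction l with
  | nil => rfl
  | cons a l ih => simp [ih]

theorem contractCheck_apply {d m : ℕ} (hd : d ∈ orders) (hm : m < 127) :
    (popCount m ≤ 5 →
      contractDefect d (contractVec d [(m, 1)]) (contractVec d (bdryCol m)) = []) ∧
    ∀ x ∈ bars d, (coefAt (contractVec d [(m, 1)]) x.tgt = 0 ∨
      (popCount m = popCount x.tgt ∧ cycMult d x.tgt ≤ cycMult d m)) ∧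
      (coefAt (contractVec d (bdryCol m)) x.tgt = 0 ∨ cycMult d x.tgt + 1 ≤ cycMult d m) := by
  have h := contractCheck_eq_true d hd m hm
  rw [contractCheck, forceVec_eq, forceVec_eq, Bool.and_eq_true, decide_eq_true_eq,
    decide_eq_true_eq] at h
  exact h

theorem contractMap_eq_sum {d k : ℕ} (hd : d ∈ orders) (hk : k ≤ 5) {z : FreeMod}
    (hz : z ∈ cycLattice d k) :
    contractMap d z = ((bars d).map fun x => contractMap d z x.tgt • toFree x.bdry +
      contractMap d (bdryMap z) x.tgt • toFree x.chain).sum := by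
  let T : FreeMod →ₗ[R] FreeMod := contractMap d - ((bars d).map fun x =>
    (Finsupp.lapply x.tgt ∘ₗ contractMap d).smulRight (toFree x.bdry) +
      (Finsupp.lapply x.tgt ∘ₗ contractMap d ∘ₗ bdryMap).smulRight (toFree x.chain)).sum
  have hT : ∀ y, T y = contractMap d y - ((bars d).map fun x =>
      contractMap d y x.tgt • toFree x.bdry +
      contractMap d (bdryMap y) x.tgt • toFree x.chain).sum := by
    intro y
    rw [LinearMap.sub_apply, sum_map_linearMap_apply]
    rfl
  have := map_mem_of_mem_degWeight T ⊥ (fun m hm hm' a _ => ?_) hz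
  · rwa [Submodule.mem_bot, hT, sub_eq_zero] at this
  · have h := congrArg toFree ((contractCheck_apply hd hm).1 (by omega))
    rw [contractDefect, toFree_collect, toFree_append, toFree_scaleVec, toFree_flatMap,
      toFree_nil] at h
    simp only [toFree_append, toFree_scaleVec, ← toFree_apply] at h
    rw [hT, contractMap_single, contractMap_bdryMap_single, sub_eq_add_neg, ← neg_one_smul R]
    push_cast at h
    rw [h, smul_zero]
    exact Submodule.zero_mem _

theorem contractMap_apply_tgt {d k : ℕ} (hd : d ∈ orders) {x : Bar} (hx : x ∈ bars d)
    {z : FreeMod} (hz : z ∈ cycLattice d k) :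
    (popCount x.tgt ≠ k → contractMap d z x.tgt = 0) ∧
      cyc d ^ cycMult d x.tgt ∣ contractMap d z x.tgt := by
  constructor
  · intro hk
    have := map_mem_of_mem_degWeight (Finsupp.lapply x.tgt ∘ₗ contractMap d) ⊥
      (fun m hm hm' a _ => ?_) hz
    · simpa using this
    · rw [LinearMap.comp_apply, contractMap_single, Finsupp.lapply_apply, toFree_apply]
      rcases ((contractCheck_apply hd hm).2 x hx).1 with h | h
      · simp [h]
      · omega
  · rw [← Ideal.mem_span_singleton]
    refine map_mem_of_mem_degWeight (Finsupp.lapply x.tgt ∘ₗ contractMap d)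
      (Ideal.span {cyc d ^ cycMult d x.tgt}) (fun m hm hm' a ha => ?_) hz
    rw [LinearMap.comp_apply, contractMap_single, Finsupp.lapply_apply, toFree_apply,
      Ideal.mem_span_singleton, smul_eq_mul]
    rcases ((contractCheck_apply hd hm).2 x hx).1 with h | h
    · simp [h]
    · exact ((pow_dvd_pow _ h.2).trans ha).mul_right _

theorem contractMap_bdryMap_apply_tgt {d k : ℕ} (hd : d ∈ orders) {x : Bar} (hx : x ∈ bars d)
    {z : FreeMod} (hz : z ∈ cycLattice d k) :
    cyc d ^ (cycMult d x.tgt + 1) ∣ contractMap d (bdryMap z) x.tgt := by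
  rw [← Ideal.mem_span_singleton]
  refine map_mem_of_mem_degWeight (Finsupp.lapply x.tgt ∘ₗ contractMap d ∘ₗ bdryMap)
    (Ideal.span {cyc d ^ (cycMult d x.tgt + 1)}) (fun m hm hm' a ha => ?_) hz
  rw [LinearMap.comp_apply, LinearMap.comp_apply, contractMap_bdryMap_single,
    Finsupp.lapply_apply, toFree_apply, Ideal.mem_span_singleton, smul_eq_mul]
  rcases ((contractCheck_apply hd hm).2 x hx).2 with h | h
  · simp [h]
  · exact ((pow_dvd_pow _ h).trans ha).mul_right _

theorem Bar.check_apply {d : ℕ} (hd : d ∈ orders) {x : Bar} (hx : x ∈ bars d) :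
    (∀ p ∈ x.chain, p.1 < 127 ∧ popCount p.1 = popCount x.tgt + 1 ∧
      cycMult d p.1 ≤ cycMult d x.tgt + 1) ∧
    (∀ p ∈ x.bdry, p.1 < 127 ∧ popCount p.1 = popCount x.tgt ∧
      cycMult d p.1 ≤ cycMult d x.tgt) := by
  have h := Bar.check_eq_true d hd x hx
  rw [Bar.check, forceVec_eq, forceVec_eq, Bool.and_eq_true, decide_eq_true_eq,
    decide_eq_true_eq] at h
  have hxd : x.d = d := by simpa using (List.mem_filter.1 hx).2
  rw [hxd] at h
  exact h

theorem bdryMap_toFree_chain (x : Bar) : bdryMap (toFree x.chain) = toFree x.bdry :=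
  colMap_toFree _ _

/-- A cycle is a boundary up to denominators prime to `Φ_d` if its coordinates along the direct
summands belonging to `d` vanish. -/
theorem exists_bdryMap_eq {d k : ℕ} (hd : d ∈ orders) (hk : k ≤ 5) {z : FreeMod}
    (hz : z ∈ cycLattice d k) (h0 : bdryMap z = 0)
    (h : ∀ x ∈ bars d, popCount x.tgt = k →
      cyc d ^ (cycMult d x.tgt + 1) ∣ contractMap d z x.tgt) :
    ∃ y ∈ cycLattice d (k + 1), z = bdryMap y := by
  obtain ⟨x, hx, hx'⟩ := exists_sub_contractMap_eq hd hz h0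
  let c := ((bars d).map fun x => contractMap d z x.tgt • toFree x.chain).sum
  have hc : c ∈ cycLattice d (k + 1) := by
    refine list_sum_mem fun y hy => ?_
    obtain ⟨x, hx, rfl⟩ := List.mem_map.1 hy
    by_cases e : popCount x.tgt = k
    · refine smul_toFree_mem_cycLattice fun p hp => ?_
      obtain ⟨h1, h2, h3⟩ := (Bar.check_apply hd hx).1 p hp
      exact ⟨h1, by omega, (pow_dvd_pow _ h3).trans (h x hx e)⟩
    · rw [(contractMap_apply_tgt hd hx hz).1 e, zero_smul]
      exact Submodule.zero_mem _
  have hc' : contractMap d z = bdryMap c := by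
    rw [contractMap_eq_sum hd hk hz, h0, map_list_sum, List.map_map]
    refine congrArg List.sum (List.map_congr_left fun x _ => ?_)
    rw [Function.comp_apply, map_smul, bdryMap_toFree_chain]
    simp
  refine ⟨x + c, add_mem hx hc, ?_⟩
  rw [map_add, ← hx', ← hc', sub_add_cancel]

end Splitting

section Coordinates

theorem nonempty_quotient_equiv_pi {A M : Type*} [CommRing A] [AddCommGroup M] [Module A M]
    {Z B : Submodule A M} {n : ℕ} (t : Fin n → A) (γ : Fin n → M →ₗ[A] A)
    (hB : ∀ z ∈ B, ∀ i, t i ∣ γ i z) (hZ : ∀ z ∈ Z, (∀ i, t i ∣ γ i z) → z ∈ B)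
    (h : ∀ i, ∃ z ∈ Z, IsCoprime (γ i z) (t i) ∧ ∀ j, j ≠ i → t j ∣ γ j z) :
    Nonempty ((Z ⧸ B.comap Z.subtype) ≃ₗ[A] ∀ i, A ⧸ Ideal.span {t i}) := by
  let f : Z →ₗ[A] ∀ i, A ⧸ Ideal.span {t i} :=
    LinearMap.pi fun i => (Submodule.mkQ (Ideal.span {t i})) ∘ₗ γ i ∘ₗ Z.subtype
  have hf : ∀ z i, f z i = Submodule.Quotient.mk (γ i z) := fun _ _ => rfl
  have hker : LinearMap.ker f = B.comap Z.subtype := by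
    ext z
    have : z ∈ LinearMap.ker f ↔ ∀ i, t i ∣ γ i z := by
      rw [LinearMap.mem_ker, funext_iff]
      simp only [hf, Pi.zero_apply, Submodule.Quotient.mk_eq_zero, Ideal.mem_span_singleton]
    rw [this, Submodule.mem_comap, Submodule.subtype_apply]
    exact ⟨hZ z z.2, hB z⟩
  have hsurj : Function.Surjective f := by
    intro v
    choose r hr using fun i => Submodule.Quotient.mk_surjective _ (v i)
    choose z hz hz1 hz2 using h
    choose a b hab using hz1
    refine ⟨∑ i, (r i * a i) • ⟨z i, hz i⟩, funext fun j => ?_⟩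
    rw [hf, ← hr j, Submodule.Quotient.eq, Ideal.mem_span_singleton]
    simp only [AddSubmonoidClass.coe_finsetSum, SetLike.val_smul, map_sum, map_smul, smul_eq_mul]
    rw [← Finset.add_sum_erase _ _ (Finset.mem_univ j), add_sub_right_comm]
    refine dvd_add ⟨-(r j * b j), ?_⟩ (Finset.dvd_sum fun i hi => ?_)
    · linear_combination r j * hab j
    · exact (hz2 i j (Finset.ne_of_mem_erase hi).symm).mul_left _
  exact ⟨(Submodule.quotEquivOfEq _ _ hker.symm).trans
    (LinearMap.quotKerEquivOfSurjective f hsurj)⟩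

theorem exists_linearMap_mul_eq {A M : Type*} [CommRing A] [IsDomain A] [AddCommGroup M]
    [Module A M] {c : A} (hc : c ≠ 0) (f : M →ₗ[A] A) (h : ∀ x, c ∣ f x) :
    ∃ γ : M →ₗ[A] A, ∀ x, f x = c * γ x := by
  choose g hg using h
  refine ⟨{ toFun := g, map_add' := fun x y => ?_, map_smul' := fun a x => ?_ }, hg⟩
  · refine mul_left_cancel₀ hc ?_
    rw [← hg, map_add, hg, hg, mul_add]
  · refine mul_left_cancel₀ hc ?_
    rw [← hg, map_smul, hg, smul_eq_mul, smul_eq_mul, RingHom.id_apply, mul_left_comm]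

/-- A multiple of the parts of all weights that are prime to `Φ_d`. -/
noncomputable def cofactor (d : ℕ) : R := ∏ e ∈ orderSet.erase d, cyc e ^ 5

theorem isCoprime_cofactor (d : ℕ) : IsCoprime (cofactor d) (cyc d) :=
  IsCoprime.prod_left fun _ he => (isCoprime_cyc (Finset.ne_of_mem_erase he)).pow_left

theorem pow_dvd_cofactor {d e : ℕ} (he : e ∈ orders) (h : e ≠ d) : cyc e ^ 5 ∣ cofactor d :=
  Finset.dvd_prod_of_mem (fun e => cyc e ^ 5) (Finset.mem_erase.2 ⟨h, mem_orders.1 he⟩)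

theorem exists_sum_mul_cofactor : ∃ μ : ℕ → R, ∑ d ∈ orderSet, μ d * cofactor d = 1 := by
  have := (exists_sum_eq_one_iff_pairwise_coprime (s := fun e => cyc e ^ 5)
    (t := orderSet) ⟨2, by decide⟩).2 fun a b hab =>
      (isCoprime_cyc fun h => hab (Subtype.ext h)).pow
  obtain ⟨μ, hμ⟩ := this
  refine ⟨μ, ?_⟩
  rw [← hμ]
  refine Finset.sum_congr rfl fun d _ => ?_
  rw [cofactor, Finset.sdiff_singleton_eq_erase]

theorem weightLattice_le_cycLattice {d : ℕ} (hd : d ∈ orders) (k : ℕ) :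
    weightLattice (degWeight weight k) ≤ cycLattice d k := by
  intro z hz m
  refine dvd_trans ?_ (hz m)
  rw [degWeight, degWeight]
  split_ifs
  · exact Finset.dvd_prod_of_mem (fun e => cyc e ^ cycMult e m) (mem_orders.1 hd)
  · exact dvd_rfl

theorem cofactor_smul_mem {d k : ℕ} (hd : d ∈ orders) {z : FreeMod} (hz : z ∈ cycLattice d k) :
    cofactor d • z ∈ weightLattice (degWeight weight k) := by
  intro m
  have h := hz m
  rw [degWeight] at h ⊢
  rw [Finsupp.smul_apply, smul_eq_mul]
  split_ifs at h ⊢ with hm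
  · rw [weight, ← Finset.mul_prod_erase _ _ (mem_orders.1 hd), mul_comm]
    refine mul_dvd_mul (Finset.prod_dvd_prod_of_dvd _ _ fun e he => pow_dvd_pow _ ?_) h
    exact (cycMult_le e (mem_orders.2 (Finset.mem_of_mem_erase he)) m hm.1).trans (by omega)
  · exact h.mul_left _

theorem barsAt_valid : ∀ k < 6, ∀ x ∈ barsAt k, x.d ∈ orders ∧ x.tgt < 127 ∧ popCount x.tgt = k := by
  decide

theorem mem_bars {d : ℕ} {x : Bar} : x ∈ bars d ↔ (∃ k < 6, x ∈ barsAt k) ∧ x.d = d := by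
  simp [bars, List.mem_filter, List.mem_flatMap]

variable {W : Type*} [Group W] {Mat : CoxeterMatrix (Fin 7)} (cs : CoxeterSystem Mat W)
  (hM : IsAffineE6 Mat)

include hM in
theorem mem_cycles_iff {k : ℕ} {z : KW cs k → R} :
    z ∈ cycles cs k ↔ bdryMap (embed cs k z) = 0 := by
  cases k with
  | zero => exact ⟨fun _ => bdryMap_eq_zero (embed_mem cs hM 0 z), fun _ => Submodule.mem_top⟩
  | succ k =>
    rw [← embed_bdry cs hM, map_eq_zero_iff _ (embed_injective cs k)]
    exact LinearMap.mem_ker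

include hM in
theorem mem_range_bdry_iff {k : ℕ} {z : KW cs k → R} : z ∈ LinearMap.range (bdry cs k) ↔
    ∃ y ∈ weightLattice (degWeight weight (k + 1)), embed cs k z = bdryMap y := by
  constructor
  · rintro ⟨y, rfl⟩
    exact ⟨_, embed_mem cs hM _ y, embed_bdry cs hM k y⟩
  · rintro ⟨y, hy, h⟩
    obtain ⟨x, rfl⟩ := exists_embed_eq cs hM hy
    rw [← embed_bdry cs hM] at h
    exact ⟨x, (embed_injective cs k h).symm⟩

include hM in
/-- A cycle is a boundary if it is one locally at every `Φ_d`. -/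
theorem mem_range_bdry_of_forall {k : ℕ} {z : KW cs k → R}
    (h : ∀ d ∈ orders, ∃ y ∈ cycLattice d (k + 1), embed cs k z = bdryMap y) :
    z ∈ LinearMap.range (bdry cs k) := by
  obtain ⟨μ, hμ⟩ := exists_sum_mul_cofactor
  rw [← one_smul R z, ← hμ, Finset.sum_smul]
  refine Submodule.sum_mem _ fun d hd => ?_
  obtain ⟨y, hy, e⟩ := h d (mem_orders.2 hd)
  rw [mul_smul]
  refine Submodule.smul_mem _ _ ((mem_range_bdry_iff cs hM).2
    ⟨_, cofactor_smul_mem (mem_orders.2 hd) hy, ?_⟩)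
  rw [map_smul, map_smul, e]

include hM in
theorem nonempty_hgy_equiv_pi {k : ℕ} (hk : k < 6) :
    Nonempty (Hgy cs k ≃ₗ[R] ∀ i : Fin (barsAt k).length, CycQuot ((barsAt k).get i).d) := by
  let x : Fin (barsAt k).length → Bar := (barsAt k).get
  have hx : ∀ i, x i ∈ barsAt k := fun i => List.get_mem _ _
  have hd : ∀ i, (x i).d ∈ orders := fun i => (barsAt_valid k hk _ (hx i)).1
  have hb : ∀ i, x i ∈ bars (x i).d := fun i => mem_bars.2 ⟨⟨k, hk, hx i⟩, rfl⟩
  have ht : ∀ i, (x i).tgt < 127 ∧ popCount (x i).tgt = k :=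
    fun i => (barsAt_valid k hk _ (hx i)).2
  have hc : ∀ i, cyc (x i).d ^ cycMult (x i).d (x i).tgt ≠ 0 :=
    fun i => pow_ne_zero _ (cyc_ne_zero _)
  have hdiv : ∀ i (z : KW cs k → R), cyc (x i).d ^ cycMult (x i).d (x i).tgt ∣
      (Finsupp.lapply (x i).tgt ∘ₗ contractMap (x i).d ∘ₗ embed cs k) z := fun i z =>
    (contractMap_apply_tgt (hd i) (hb i)
      (weightLattice_le_cycLattice (hd i) k (embed_mem cs hM k z))).2
  choose γ hγ using fun i => exists_linearMap_mul_eq (hc i) _ (hdiv i)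
  replace hγ : ∀ i z, contractMap (x i).d (embed cs k z) (x i).tgt =
    cyc (x i).d ^ cycMult (x i).d (x i).tgt * γ i z := hγ
  have key : ∀ i z, cyc (x i).d ∣ γ i z ↔ cyc (x i).d ^ (cycMult (x i).d (x i).tgt + 1) ∣
      contractMap (x i).d (embed cs k z) (x i).tgt := by
    intro i z
    rw [hγ, pow_succ, mul_dvd_mul_iff_left (hc i)]
  refine nonempty_quotient_equiv_pi (fun i => cyc (x i).d) γ ?_ ?_ ?_
  · intro z hz i
    obtain ⟨y, hy, e⟩ := (mem_range_bdry_iff cs hM).1 hz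
    rw [key, e]
    exact contractMap_bdryMap_apply_tgt (hd i) (hb i) (weightLattice_le_cycLattice (hd i) _ hy)
  · intro z hz h
    refine mem_range_bdry_of_forall cs hM fun d hd' => exists_bdryMap_eq hd' (by omega)
      (weightLattice_le_cycLattice hd' k (embed_mem cs hM k z)) ((mem_cycles_iff cs hM).1 hz)
      fun b hb' hb'' => ?_
    obtain ⟨⟨k', hk', hbk⟩, rfl⟩ := mem_bars.1 hb'
    obtain rfl : k' = k := (barsAt_valid k' hk' b hbk).2.2.symm.trans hb''
    obtain ⟨i, rfl⟩ := List.mem_iff_get.1 hbk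
    exact (key i z).1 (h i)
  · intro i
    obtain ⟨h1, h2⟩ := Bar.check_apply (hd i) (hb i)
    have hl : cyc (x i).d ^ cycMult (x i).d (x i).tgt • toFree (x i).bdry ∈
        cycLattice (x i).d k := smul_toFree_mem_cycLattice fun p hp =>
      ⟨(h2 p hp).1, (h2 p hp).2.1.trans (ht i).2, pow_dvd_pow _ (h2 p hp).2.2⟩
    have h0 : bdryMap (toFree (x i).bdry) = 0 := by
      have : cyc (x i).d ^ (cycMult (x i).d (x i).tgt + 1) • toFree (x i).chain ∈
          cycLattice (x i).d (k + 1) := smul_toFree_mem_cycLattice fun p hp =>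
        ⟨(h1 p hp).1, (h1 p hp).2.1.trans (by rw [(ht i).2]), pow_dvd_pow _ (h1 p hp).2.2⟩
      have := bdryMap_bdryMap this
      rw [map_smul, map_smul, bdryMap_toFree_chain] at this
      exact (smul_eq_zero.1 this).resolve_left (pow_ne_zero _ (cyc_ne_zero _))
    obtain ⟨z, hz⟩ := exists_embed_eq cs hM (cofactor_smul_mem (hd i) hl)
    have hγz : ∀ j, cyc (x j).d ^ cycMult (x j).d (x j).tgt * γ j z =
        cofactor (x i).d * (cyc (x i).d ^ cycMult (x i).d (x i).tgt *
          (coefAt (contractVec (x j).d (x i).bdry) (x j).tgt : R)) := by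
      intro j
      rw [← hγ, hz, map_smul, map_smul, contractMap_toFree, Finsupp.smul_apply,
        Finsupp.smul_apply, toFree_apply, smul_eq_mul, smul_eq_mul]
    refine ⟨z, (mem_cycles_iff cs hM).2 ?_, ?_, fun j hj => ?_⟩
    · rw [hz, map_smul, map_smul, h0, smul_zero, smul_zero]
    · have h := hγz i
      rw [coefAt_bdry k hk i i rfl, if_pos rfl, Int.cast_one, mul_one, mul_comm] at h
      rw [mul_right_cancel₀ (hc i) h]
      exact isCoprime_cofactor _
    · by_cases e : (x i).d = (x j).d
      · have h := hγz j
        rw [coefAt_bdry k hk i j e, if_neg hj.symm, Int.cast_zero, mul_zero, mul_zero] at h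
        rw [(mul_eq_zero.1 h).resolve_left (hc j)]
        exact dvd_zero _
      · rw [key, hγ, hγz]
        refine Dvd.dvd.mul_right ((pow_dvd_pow _ ?_).trans
          (pow_dvd_cofactor (hd j) (Ne.symm e))) _
        exact Nat.succ_le_succ (cycMult_le _ (hd j) _ (ht j).1)

end Coordinates

section TopDegree

/-- The columns of the operator that adds the vertex `0`. -/
def coneCol (m : ℕ) : SparseVec := if m.testBit 0 then [] else [(m + 1, 1)]

theorem collect_cone_eq_nil : ∀ m < 127, popCount m = 6 →
    collect ((m, 1) :: scaleVec (-1) (scaleVec (if m = 126 then 1 else 0) (bdryCol 127) ++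
      applyCol coneCol (bdryCol m))) = [] := by
  decide +kernel

theorem eq_smul_of_bdryMap_eq_zero {w : ℕ → R} {z : FreeMod}
    (hz : z ∈ weightLattice (degWeight w 6)) (h0 : bdryMap z = 0) :
    z = z 126 • toFree (bdryCol 127) := by
  let T : FreeMod →ₗ[R] FreeMod := LinearMap.id -
    ((Finsupp.lapply 126).smulRight (toFree (bdryCol 127)) + colMap coneCol ∘ₗ bdryMap)
  have hT : ∀ y, T y = y - (y 126 • toFree (bdryCol 127) + colMap coneCol (bdryMap y)) :=
    fun _ => rfl
  have := map_mem_of_mem_degWeight T ⊥ (fun m hm hk a _ => ?_) hz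
  · rwa [Submodule.mem_bot, hT, h0, map_zero, add_zero, sub_eq_zero] at this
  · have h := congrArg toFree (collect_cone_eq_nil m hm hk)
    rw [toFree_collect, toFree_cons, toFree_scaleVec, toFree_append, toFree_scaleVec] at h
    rw [hT, bdryMap, colMap_single, colMap_toFree, Finsupp.single_apply]
    have e : ((if m = 126 then 1 else 0 : ℤ) : R) = if m = 126 then 1 else 0 := by
      split_ifs <;> simp
    rw [e] at h
    rw [Submodule.mem_bot, smul_eq_zero]
    right
    simpa only [Int.cast_neg, Int.cast_one, neg_smul, one_smul, ← sub_eq_add_neg, toFree_nil] using h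

theorem bdryCol_top : ∀ p ∈ bdryCol 127, p.1 < 127 ∧ popCount p.1 = 6 ∧
    ∀ d ∈ orders, cycMult d p.1 ≤ cycMult d 126 := by
  decide +kernel

variable {W : Type*} [Group W] {Mat : CoxeterMatrix (Fin 7)} (cs : CoxeterSystem Mat W)
  (hM : IsAffineE6 Mat)

include hM in
theorem isEmpty_KW {k : ℕ} (hk : 7 ≤ k) : IsEmpty (KW cs k) := by
  refine ⟨fun σ => ?_⟩
  have h := (finite_parabolic_iff cs hM _).1 σ.2.2
  rw [toMask_lt_iff] at h
  refine h ((Finset.card_eq_iff_eq_univ _).1 (le_antisymm (Finset.card_le_univ _) ?_))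
  rw [σ.2.1, Fintype.card_fin]
  exact hk

include hM in
theorem subsingleton_hgy {k : ℕ} (hk : 7 ≤ k) : Subsingleton (Hgy cs k) := by
  have := isEmpty_KW cs hM hk
  infer_instance

include hM in
theorem nonempty_hgy_six_equiv : Nonempty (Hgy cs 6 ≃ₗ[R] R) := by
  have hmem : weight 126 • toFree (bdryCol 127) ∈ weightLattice (degWeight weight 6) := by
    refine smul_toFree_mem_weightLattice fun p hp => ?_
    obtain ⟨h1, h2, h3⟩ := bdryCol_top p hp
    rw [degWeight, if_pos ⟨h1, h2⟩]
    exact Finset.prod_dvd_prod_of_dvd _ _ fun d hd => pow_dvd_pow _ (h3 d (mem_orders.2 hd))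
  obtain ⟨y, hy⟩ := exists_embed_eq cs hM hmem
  have hcyc : y ∈ cycles cs 6 := by
    have h : applyCol bdryCol (bdryCol 127) = [] := by decide +kernel
    rw [mem_cycles_iff cs hM, hy, map_smul, bdryMap, colMap_toFree, h, toFree_nil, smul_zero]
  have h126 : toFree (bdryCol 127) 126 = 1 := by
    have h : coefAt (bdryCol 127) 126 = 1 := by decide +kernel
    rw [toFree_apply, h, Int.cast_one]
  have hinj : Function.Injective (LinearMap.toSpanSingleton R (cycles cs 6) ⟨y, hcyc⟩) := by
    intro a b hab
    have := congrArg (fun z : cycles cs 6 => embed cs 6 z.1 126) hab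
    simp only [LinearMap.toSpanSingleton_apply, SetLike.val_smul, map_smul, hy,
      Finsupp.smul_apply, h126, smul_eq_mul, mul_one] at this
    exact mul_right_cancel₀ (weight_ne_zero 126) this
  have hsurj : Function.Surjective (LinearMap.toSpanSingleton R (cycles cs 6) ⟨y, hcyc⟩) := by
    intro z
    have hz := embed_mem cs hM 6 z.1
    have e := eq_smul_of_bdryMap_eq_zero hz ((mem_cycles_iff cs hM).1 z.2)
    obtain ⟨a, ha⟩ := hz 126
    rw [degWeight, if_pos (by decide)] at ha
    refine ⟨a, Subtype.ext (embed_injective cs 6 ?_)⟩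
    rw [LinearMap.toSpanSingleton_apply, SetLike.val_smul, map_smul, hy, e, ha, smul_smul, mul_comm]
  have hbot : Submodule.comap (cycles cs 6).subtype (LinearMap.range (bdry cs 6)) = ⊥ := by
    have := isEmpty_KW cs hM le_rfl
    have : bdry cs 6 = 0 := LinearMap.ext fun x => by
      rw [Subsingleton.elim x 0, map_zero, map_zero]
    rw [this, LinearMap.range_zero, Submodule.comap_bot, Submodule.ker_subtype]
  exact ⟨(Submodule.quotEquivOfEqBot _ hbot).trans
    (LinearEquiv.ofBijective _ ⟨hinj, hsurj⟩).symm⟩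

theorem isAffineE6_of_lt (h : ∀ i j : Fin 7, i.val < j.val →
    Mat.M i j = (if (i.val, j.val) ∈
      ([(0, 2), (1, 3), (2, 4), (3, 4), (4, 5), (5, 6)] : List (ℕ × ℕ)) then 3 else 2)) :
    IsAffineE6 Mat := by
  have hadj : ∀ i j : Fin 7, i.val < j.val → ((i.val, j.val) ∈
      ([(0, 2), (1, 3), (2, 4), (3, 4), (4, 5), (5, 6)] : List (ℕ × ℕ)) ↔ adjE6 i j) ∧
      (adjE6 i j ↔ adjE6 j i) := by decide
  intro i j hij
  rcases lt_or_gt_of_ne (Fin.val_ne_of_ne hij) with hl | hl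
  · exact (h i j hl).trans (if_congr (hadj i j hl).1 rfl rfl)
  · rw [Mat.symmetric i j]
    exact (h j i hl).trans (if_congr ((hadj j i hl).1.trans (hadj j i hl).2) rfl rfl)

end TopDegree

section Products

theorem nonempty_pi_cons_equiv {P : Type*} [AddCommGroup P] [Module R P] (x : Bar) {l : List Bar}
    (h : Nonempty ((∀ i : Fin l.length, CycQuot (l.get i).d) ≃ₗ[R] P)) :
    Nonempty ((∀ i : Fin (x :: l).length, CycQuot ((x :: l).get i).d) ≃ₗ[R] CycQuot x.d × P) :=
  h.map fun e => (Fin.consLinearEquiv R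
    fun i : Fin (l.length + 1) => CycQuot ((x :: l).get i).d).symm.trans
      ((LinearEquiv.refl R _).prodCongr e)

theorem nonempty_pi_singleton_equiv (x : Bar) :
    Nonempty ((∀ i : Fin [x].length, CycQuot ([x].get i).d) ≃ₗ[R] CycQuot x.d) :=
  ⟨LinearEquiv.piUnique R fun i : Fin 1 => CycQuot ([x].get i).d⟩

end Products

/-- Homology of the weighted complex for the affine Coxeter system of type `Ẽ₆` (generators indexed by `0,…,6`). -/
theorem homology_affine_E6 {W : Type*} [Group W] {Mat : CoxeterMatrix (Fin 7)}
    (cs : CoxeterSystem Mat W)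
    (hM : ∀ i j : Fin 7, i.val < j.val →
      Mat.M i j = (if (i.val, j.val) ∈ ([(0, 2), (1, 3), (2, 4), (3, 4), (4, 5), (5, 6)] : List (ℕ × ℕ)) then 3 else 2)) :
    Nonempty (Hgy cs 0 ≃ₗ[R] (CycQuot 2)) ∧
    Subsingleton (Hgy cs 1) ∧
    Subsingleton (Hgy cs 2) ∧
    Nonempty (Hgy cs 3 ≃ₗ[R] (CycQuot 3)) ∧
    Nonempty (Hgy cs 4 ≃ₗ[R] (CycQuot 5 × CycQuot 8)) ∧
    Nonempty (Hgy cs 5 ≃ₗ[R] (CycQuot 2 × CycQuot 3 × CycQuot 3 × CycQuot 3 × CycQuot 6 × CycQuot 6 × CycQuot 9 × CycQuot 9 × CycQuot 12 × CycQuot 12)) ∧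
    Nonempty (Hgy cs 6 ≃ₗ[R] R) ∧
    (∀ k, 7 ≤ k → Subsingleton (Hgy cs k)) := by
  have hM := isAffineE6_of_lt hM
  have h {k : ℕ} (hk : k < 6) {P : Type} [AddCommGroup P] [Module R P] (e : Nonempty
      ((∀ i : Fin (barsAt k).length, CycQuot ((barsAt k).get i).d) ≃ₗ[R] P)) :
      Nonempty (Hgy cs k ≃ₗ[R] P) :=
    (nonempty_hgy_equiv_pi cs hM hk).elim fun e₁ => e.map e₁.trans
  have h0 {k : ℕ} (hk : k < 6) (hb : barsAt k = []) : Subsingleton (Hgy cs k) := by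
    obtain ⟨e⟩ := nonempty_hgy_equiv_pi cs hM hk
    have : IsEmpty (Fin (barsAt k).length) := by rw [hb]; exact Fin.isEmpty
    exact e.toEquiv.subsingleton
  refine ⟨h (by norm_num) ?_, h0 (by norm_num) rfl, h0 (by norm_num) rfl, h (by norm_num) ?_,
    h (by norm_num) ?_, h (by norm_num) ?_, nonempty_hgy_six_equiv cs hM,
    fun k hk => subsingleton_hgy cs hM hk⟩
  · exact nonempty_pi_singleton_equiv _
  · exact nonempty_pi_singleton_equiv _
  · exact nonempty_pi_cons_equiv _ (nonempty_pi_singleton_equiv _)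
  · iterate 9 refine nonempty_pi_cons_equiv _ ?_
    exact nonempty_pi_singleton_equiv _
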